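/- arXiv:2502.03112 — 2 statements merged into one kernel-verified Lean document; each statement's English description precedes it below -/
import Mathlib

section
/- Let (X, μ, T) be an ergodic measure preserving system on a compact metric space, let a ∈ X be T-generic for μ along some Følner sequence Φ in ℕ, let ℓ, m be positive integers, and let E, F ⊆ X be open sets with (ℓ+m)·μ(F) + ℓ·μ(E) > 2ℓ + m − 1. Then there exist x₁, x₂ ∈ X such that (a, x₁, x₂) is an (ℓ,m)-Erdős progression and (x₁, x₂) ∈ E × F. -/
open Filter MeasureTheory Topology

/-- A Følner sequence in `ℕ`. -/
def IsFolnerSeq (Φ : ℕ → Finset ℕ) : Prop :=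
  (∀ N, (Φ N).Nonempty) ∧
  ∀ t : ℕ, Filter.Tendsto
    (fun N => ((Φ N ∩ (Φ N).image (fun n => t + n)).card : ℝ) / ((Φ N).card : ℝ))
    Filter.atTop (nhds 1)

/-- `a` is `T`-generic for `μ` along the Følner sequence `Φ`: the empirical measures
along orbits converge to `μ` in the weak* topology. -/
def GenericAlong {X : Type*} [TopologicalSpace X] [MeasurableSpace X]
    (T : X → X) (μ : MeasureTheory.Measure X) (a : X) (Φ : ℕ → Finset ℕ) : Prop :=
  ∀ f : C(X, ℝ), Filter.Tendsto
    (fun N => (∑ n ∈ Φ N, f (T^[n] a)) / ((Φ N).card : ℝ))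
    Filter.atTop (nhds (∫ x, f x ∂μ))

/-- `(x₀, x₁, x₂)` is an `(ℓ,m)`-Erdős progression for `T`. -/
def ErdosProg {X : Type*} [TopologicalSpace X] (T : X → X) (ℓ m : ℕ)
    (x₀ x₁ x₂ : X) : Prop :=
  ∃ n : ℕ → ℕ, StrictMono n ∧ (∀ i, 0 < n i) ∧
    Filter.Tendsto (fun i => (T^[ℓ * n i] x₀, T^[m * n i] x₁)) Filter.atTop
      (nhds (x₁, x₂))

/-- Bounded real sequences. -/
def BddSeq (g : ℕ → ℝ) : Prop := ∃ C, ∀ n, |g n| ≤ C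

/-- A shift invariant mean on bounded sequences. -/
structure IsShiftMean (M : (ℕ → ℝ) → ℝ) : Prop where
  add : ∀ g h, BddSeq g → BddSeq h → M (fun n => g n + h n) = M g + M h
  smul : ∀ (c : ℝ) g, BddSeq g → M (fun n => c * g n) = c * M g
  mono : ∀ g h, BddSeq g → BddSeq h → (∀ n, g n ≤ h n) → M g ≤ M h
  one : M (fun _ => 1) = 1
  shift : ∀ g, BddSeq g → M (fun n => g (n + 1)) = M g

lemma BddSeq.add {g h : ℕ → ℝ} (hg : BddSeq g) (hh : BddSeq h) :
    BddSeq (fun n => g n + h n) := by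
  obtain ⟨C, hC⟩ := hg
  obtain ⟨D, hD⟩ := hh
  exact ⟨C + D, fun n => (abs_add_le _ _).trans (add_le_add (hC n) (hD n))⟩

lemma BddSeq.smul {g : ℕ → ℝ} (c : ℝ) (hg : BddSeq g) :
    BddSeq (fun n => c * g n) := by
  obtain ⟨C, hC⟩ := hg
  exact ⟨|c| * C, fun n => by
    rw [abs_mul]; exact mul_le_mul_of_nonneg_left (hC n) (abs_nonneg _)⟩

lemma bddSeq_const (c : ℝ) : BddSeq (fun _ => c) := ⟨|c|, fun _ => le_rfl⟩

lemma avg_abs_le {g : ℕ → ℝ} {C : ℝ} (hC : ∀ n, |g n| ≤ C) (s : Finset ℕ) (hs : s.Nonempty) :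
    |(∑ n ∈ s, g n) / (s.card : ℝ)| ≤ C := by
  have hpos : (0 : ℝ) < s.card := by exact_mod_cast hs.card_pos
  rw [abs_div, abs_of_pos hpos, div_le_iff₀ hpos]
  calc |∑ n ∈ s, g n| ≤ ∑ n ∈ s, |g n| := Finset.abs_sum_le_sum_abs _ _
    _ ≤ ∑ n ∈ s, C := Finset.sum_le_sum (fun n _ => hC n)
    _ = C * s.card := by simp [mul_comm]

lemma folner_shift {g : ℕ → ℝ} {C : ℝ} (hC : ∀ n, |g n| ≤ C) (s : Finset ℕ) (hs : s.Nonempty) :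
    |(∑ n ∈ s, g (n + 1)) / (s.card : ℝ) - (∑ n ∈ s, g n) / (s.card : ℝ)| ≤
      2 * C * (1 - ((s ∩ s.image (fun n => 1 + n)).card : ℝ) / (s.card : ℝ)) := by
  have hpos : (0 : ℝ) < s.card := by exact_mod_cast hs.card_pos
  set s' := s.image (fun n => 1 + n) with hs'
  have hinj : Function.Injective (fun n : ℕ => 1 + n) := fun a b h => by simpa using h
  have hcard : s'.card = s.card := Finset.card_image_of_injective _ hinj
  have h1 : ∑ n ∈ s, g (n + 1) = ∑ n ∈ s', g n := by
    rw [hs', Finset.sum_image (fun a _ b _ h => hinj h)]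
    simp [add_comm]
  have h2 : ∑ n ∈ s', g n = ∑ n ∈ s' \ s, g n + ∑ n ∈ s ∩ s', g n := by
    rw [Finset.inter_comm, ← Finset.sum_union (Finset.disjoint_sdiff_inter _ _),
      Finset.sdiff_union_inter]
  have h3 : ∑ n ∈ s, g n = ∑ n ∈ s \ s', g n + ∑ n ∈ s ∩ s', g n := by
    rw [← Finset.sum_union (Finset.disjoint_sdiff_inter _ _), Finset.sdiff_union_inter]
  have bound : ∀ u : Finset ℕ, |∑ n ∈ u, g n| ≤ C * u.card := fun u => by
    calc |∑ n ∈ u, g n| ≤ ∑ n ∈ u, |g n| := Finset.abs_sum_le_sum_abs _ _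
    _ ≤ ∑ n ∈ u, C := Finset.sum_le_sum (fun n _ => hC n)
    _ = C * u.card := by simp [mul_comm]
  have c1 : ((s' \ s).card : ℝ) = s.card - (s ∩ s').card := by
    have := Finset.card_sdiff_add_card_inter s' s
    rw [Finset.inter_comm, hcard] at this
    rw [← this]; push_cast; ring
  have c2 : ((s \ s').card : ℝ) = s.card - (s ∩ s').card := by
    have := Finset.card_sdiff_add_card_inter s s'
    rw [← this]; push_cast; ring
  rw [← sub_div, h1, h2, h3, abs_div, abs_of_pos hpos, div_le_iff₀ hpos]
  have e : 2 * C * (1 - ((s ∩ s').card : ℝ) / s.card) * s.card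
      = C * (s' \ s).card + C * (s \ s').card := by
    rw [c1, c2]; field_simp; ring
  rw [e]
  have := abs_sub (∑ n ∈ s' \ s, g n) (∑ n ∈ s \ s', g n)
  calc _ = |∑ n ∈ s' \ s, g n - ∑ n ∈ s \ s', g n| := by congr 1; ring
    _ ≤ _ := this
    _ ≤ _ := add_le_add (bound _) (bound _)

lemma exists_mean (Φ : ℕ → Finset ℕ) (hΦ : IsFolnerSeq Φ) :
    ∃ M : (ℕ → ℝ) → ℝ, IsShiftMean M ∧
      ∀ g c, Tendsto (fun N => (∑ n ∈ Φ N, g n) / ((Φ N).card : ℝ)) atTop (𝓝 c) → M g = c := by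
  let U : Ultrafilter ℕ := hyperfilter ℕ
  let A : (ℕ → ℝ) → ℕ → ℝ := fun g N => (∑ n ∈ Φ N, g n) / ((Φ N).card : ℝ)
  have hU : (U : Filter ℕ) ≤ atTop := by
    rw [← Nat.cofinite_eq_atTop]; exact hyperfilter_le_cofinite
  have hlim : ∀ g, BddSeq g → Tendsto (A g) U (𝓝 (limUnder (U : Filter ℕ) (A g))) := by
    rintro g ⟨C, hC⟩
    apply tendsto_nhds_limUnder
    have hc : IsCompact (Set.Icc (-C) C) := isCompact_Icc
    obtain ⟨x, _, hx⟩ := hc.ultrafilter_le_nhds (U.map (A g)) (by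
      rw [Filter.le_principal_iff]
      refine Filter.mem_map.2 (Filter.univ_mem' fun N => ?_)
      exact abs_le.1 (avg_abs_le hC _ (hΦ.1 N)))
    exact ⟨x, hx⟩
  refine ⟨fun g => limUnder (U : Filter ℕ) (A g), ⟨?_, ?_, ?_, ?_, ?_⟩, ?_⟩
  · intro g h hg hh
    refine tendsto_nhds_unique (hlim _ (hg.add hh)) ?_
    refine ((hlim g hg).add (hlim h hh)).congr fun N => ?_
    simp only [A, Finset.sum_add_distrib, add_div]
  · intro c g hg
    refine tendsto_nhds_unique (hlim _ (hg.smul c)) ?_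
    refine ((hlim g hg).const_mul c).congr fun N => ?_
    simp only [A, ← Finset.mul_sum, mul_div_assoc]
  · intro g h hg hh hgh
    refine le_of_tendsto_of_tendsto' (hlim g hg) (hlim h hh) fun N => ?_
    exact div_le_div_of_nonneg_right (Finset.sum_le_sum fun n _ => hgh n) (Nat.cast_nonneg _)
  · refine tendsto_nhds_unique (hlim _ (bddSeq_const 1)) ?_
    refine tendsto_const_nhds.congr fun N => ?_
    have hpos : (0 : ℝ) < (Φ N).card := by exact_mod_cast (hΦ.1 N).card_pos
    simp [A, hpos.ne']
  · intro g hg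
    have hg' : BddSeq (fun n => g (n + 1)) := ⟨hg.choose, fun n => hg.choose_spec _⟩
    obtain ⟨C, hC⟩ := hg
    refine tendsto_nhds_unique (hlim _ hg') ?_
    have h0 : Tendsto (fun N => A (fun n => g (n + 1)) N - A g N) U (𝓝 0) := by
      refine squeeze_zero_norm (fun N => folner_shift hC (Φ N) (hΦ.1 N)) ?_
      have := ((tendsto_const_nhds (x := (1 : ℝ))).sub (hΦ.2 1)).const_mul (2 * C)
      simp only [sub_self, mul_zero] at this
      exact this.mono_left hU
    have := h0.add (hlim g ⟨C, hC⟩)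
    simpa using this
  · intro g c h
    exact (h.mono_left hU).limUnder_eq

lemma IsShiftMean.const {M : (ℕ → ℝ) → ℝ} (hM : IsShiftMean M) (c : ℝ) : M (fun _ => c) = c := by
  have := hM.smul c (fun _ => 1) (bddSeq_const 1)
  simpa [hM.one] using this

lemma IsShiftMean.shift_iter {M : (ℕ → ℝ) → ℝ} (hM : IsShiftMean M) {g : ℕ → ℝ}
    (hg : BddSeq g) (k : ℕ) : M (fun n => g (n + k)) = M g := by
  induction k with
  | zero => simp
  | succ k ih =>
    rw [← ih]
    have := hM.shift (fun n => g (n + k)) ⟨hg.choose, fun n => hg.choose_spec _⟩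
    rw [← this]
    congr 1; ext n; congr 1; ring

lemma IsShiftMean.mono_eventually {M : (ℕ → ℝ) → ℝ} (hM : IsShiftMean M) {g h : ℕ → ℝ}
    (hg : BddSeq g) (hh : BddSeq h) (k : ℕ) (hle : ∀ n, k ≤ n → g n ≤ h n) : M g ≤ M h := by
  rw [← hM.shift_iter hg k, ← hM.shift_iter hh k]
  exact hM.mono _ _ ⟨hg.choose, fun n => hg.choose_spec _⟩ ⟨hh.choose, fun n => hh.choose_spec _⟩
    (fun n => hle _ (Nat.le_add_left _ _))

lemma IsShiftMean.finset_sum {M : (ℕ → ℝ) → ℝ} (hM : IsShiftMean M) (s : Finset ℕ)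
    (g : ℕ → ℕ → ℝ) (hg : ∀ i, BddSeq (g i)) :
    BddSeq (fun n => ∑ i ∈ s, g i n) ∧ M (fun n => ∑ i ∈ s, g i n) = ∑ i ∈ s, M (g i) := by
  classical
  induction s using Finset.induction_on with
  | empty => exact ⟨by simpa using bddSeq_const 0, by simpa using hM.const 0⟩
  | insert i s hi ih =>
    simp only [Finset.sum_insert hi]
    exact ⟨(hg i).add ih.1, by rw [hM.add _ _ (hg i) ih.1, ih.2]⟩

/-- Restriction of a mean to multiples of `ℓ`. -/
noncomputable def divMean (M : (ℕ → ℝ) → ℝ) (ℓ : ℕ) (g : ℕ → ℝ) : ℝ :=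
  ℓ * M (fun n => if ℓ ∣ n then g (n / ℓ) else 0)

lemma bdd_divSeq {g : ℕ → ℝ} (hg : BddSeq g) (ℓ : ℕ) :
    BddSeq (fun n => if ℓ ∣ n then g (n / ℓ) else 0) := by
  obtain ⟨C, hC⟩ := hg
  refine ⟨C, fun n => ?_⟩
  dsimp only
  split_ifs
  · exact hC _
  · simpa using (abs_nonneg _).trans (hC 0)

lemma divMean_isShiftMean {M : (ℕ → ℝ) → ℝ} (hM : IsShiftMean M) {ℓ : ℕ} (hℓ : 0 < ℓ) :
    IsShiftMean (divMean M ℓ) := by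
  refine ⟨?_, ?_, ?_, ?_, ?_⟩
  · intro g h hg hh
    unfold divMean
    rw [← mul_add, ← hM.add _ _ (bdd_divSeq hg ℓ) (bdd_divSeq hh ℓ)]
    congr 2; ext n; split_ifs <;> simp
  · intro c g hg
    unfold divMean
    rw [mul_left_comm, ← hM.smul _ _ (bdd_divSeq hg ℓ)]
    congr 2; ext n; split_ifs <;> simp
  · intro g h hg hh hgh
    unfold divMean
    refine mul_le_mul_of_nonneg_left (hM.mono _ _ (bdd_divSeq hg ℓ) (bdd_divSeq hh ℓ) ?_)
      (Nat.cast_nonneg _)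
    intro n; split_ifs
    · exact hgh _
    · exact le_rfl
  · unfold divMean
    have hb := bdd_divSeq (bddSeq_const 1) ℓ
    have h := hM.finset_sum (Finset.range ℓ)
      (fun i n => if ℓ ∣ n + i then (1 : ℝ) else 0)
      (fun i => ⟨hb.choose, fun n => hb.choose_spec (n + i)⟩)
    have h2 : ∀ i, M (fun n => if ℓ ∣ n + i then (1 : ℝ) else 0)
        = M (fun n => if ℓ ∣ n then (1 : ℝ) else 0) := fun i =>
      hM.shift_iter hb i
    have h3 : (fun n : ℕ => ∑ i ∈ Finset.range ℓ, if ℓ ∣ n + i then (1 : ℝ) else 0)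
        = fun _ => 1 := by
      ext n
      rw [Finset.sum_eq_single ((ℓ - n % ℓ) % ℓ)]
      · rw [if_pos]
        rw [Nat.dvd_iff_mod_eq_zero, Nat.add_mod, Nat.mod_mod]
        have := Nat.mod_lt n hℓ
        by_cases h0 : n % ℓ = 0
        · simp [h0]
        · rw [Nat.mod_eq_of_lt (a := ℓ - n % ℓ) (by omega)]
          have : n % ℓ + (ℓ - n % ℓ) = ℓ := by omega
          simp [this]
      · intro i hi hne
        rw [if_neg]
        intro hd
        apply hne
        rw [Finset.mem_range] at hi
        obtain ⟨c, hc⟩ := hd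
        have := Nat.mod_lt n hℓ
        have hn := Nat.div_add_mod n ℓ
        have hmod : (n % ℓ + i) % ℓ = 0 := by
          rw [Nat.mod_add_mod, hc]; simp
        by_cases h0 : n % ℓ = 0
        · rw [h0, zero_add, Nat.mod_eq_of_lt hi] at hmod
          simp [h0, hmod]
        · have : ℓ ∣ n % ℓ + i := Nat.dvd_of_mod_eq_zero hmod
          obtain ⟨d, hd⟩ := this
          have : d = 1 := by
            rcases d with _ | _ | d
            · omega
            · rfl
            · nlinarith
          subst this
          rw [Nat.mod_eq_of_lt (by omega)]
          omega
      · intro hn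
        exact absurd (Finset.mem_range.2 (Nat.mod_lt _ hℓ)) hn
    rw [h3, hM.one] at h
    simp only [h2, Finset.sum_const, Finset.card_range, nsmul_eq_mul] at h
    exact h.2.symm
  · intro g hg
    unfold divMean
    rw [← hM.shift_iter (bdd_divSeq hg ℓ) ℓ]
    congr 2; ext n
    simp [Nat.add_div_right n hℓ]

/-- Riesz representation on compact metric spaces. -/
lemma exists_riesz {Y : Type*} [MetricSpace Y] [CompactSpace Y] [MeasurableSpace Y] [BorelSpace Y]
    (L : C(Y, ℝ) → ℝ) (hadd : ∀ f g, L (f + g) = L f + L g)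
    (hsmul : ∀ (c : ℝ) f, L (c • f) = c * L f) (hpos : ∀ f : C(Y, ℝ), (∀ y, 0 ≤ f y) → 0 ≤ L f) :
    ∃ m : Measure Y, IsFiniteMeasure m ∧ ∀ f : C(Y, ℝ), ∫ y, f y ∂m = L f := by
  let Λ : CompactlySupportedContinuousMap Y ℝ →ₚ[ℝ] ℝ := PositiveLinearMap.mk₀
    { toFun := fun f => L f.toContinuousMap
      map_add' := fun f g => by rw [← hadd]; rfl
      map_smul' := fun c f => by simp only [RingHom.id_apply, smul_eq_mul]; rw [← hsmul]; rfl }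
    (fun f hf => hpos _ hf)
  refine ⟨RealRMK.rieszMeasure Λ, inferInstance, fun f => ?_⟩
  have := RealRMK.integral_rieszMeasure Λ (CompactlySupportedContinuousMap.continuousMapEquiv f)
  exact this

lemma koopman_iter_coe {X : Type*} [MeasurableSpace X] {μ : Measure X} [IsProbabilityMeasure μ]
    {T : X → X} (hT : MeasurePreserving T μ μ) {q : X → ℝ} (hq : MemLp q 2 μ) (n : ℕ) :
    ((Lp.compMeasurePreservingₗᵢ ℝ T hT (p := 2) (E := ℝ)).toContinuousLinearMap^[n]
      (hq.toLp q) : X → ℝ) =ᵐ[μ] fun x => q (T^[n] x) := by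
  induction n with
  | zero => simpa using hq.coeFn_toLp
  | succ n ih =>
    rw [Function.iterate_succ_apply']
    have h1 := Lp.coeFn_compMeasurePreserving (p := 2)
      ((Lp.compMeasurePreservingₗᵢ ℝ T hT (p := 2) (E := ℝ)).toContinuousLinearMap^[n]
      (hq.toLp q)) hT
    refine h1.trans ?_
    have h2 := hT.quasiMeasurePreserving.ae_eq_comp ih
    refine h2.trans (Eventually.of_forall fun x => ?_)
    simp [Function.comp, Function.iterate_succ_apply]

lemma int_abs_le_norm {X : Type*} [MeasurableSpace X] {μ : Measure X} [IsProbabilityMeasure μ]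
    (h : Lp ℝ 2 μ) : ∫ x, |h x| ∂μ ≤ ‖h‖ := by
  rw [Lp.norm_def]
  have h1 : ∫ x, |h x| ∂μ = (eLpNorm h 1 μ).toReal := by
    have := integral_norm_eq_lintegral_enorm (Lp.aestronglyMeasurable h)
    simp only [Real.norm_eq_abs] at this
    rw [this, eLpNorm_one_eq_lintegral_enorm]
  rw [h1]
  apply ENNReal.toReal_mono (Lp.eLpNorm_ne_top h)
  exact eLpNorm_le_eLpNorm_of_exponent_le (by norm_num) (Lp.aestronglyMeasurable h)

lemma mean_ergodic {X : Type*} [MeasurableSpace X] {μ : Measure X} [IsProbabilityMeasure μ]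
    {T : X → X} (hT : Ergodic T μ) {q : X → ℝ} (hqm : Measurable q) (hq1 : ∀ x, |q x| ≤ 1) :
    Tendsto (fun N : ℕ => ∫ x, |(N : ℝ)⁻¹ * ∑ n ∈ Finset.range N, q (T^[n] x) - ∫ y, q y ∂μ| ∂μ)
      atTop (𝓝 0) := by
  have hmp := hT.toMeasurePreserving
  have hq : MemLp q 2 μ := MemLp.of_bound hqm.aestronglyMeasurable 1
    (Eventually.of_forall fun x => by simpa using hq1 x)
  set U := (Lp.compMeasurePreservingₗᵢ ℝ T hmp (p := 2) (E := ℝ)).toContinuousLinearMap with hU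
  have hUn : ‖U‖ ≤ 1 := LinearIsometry.norm_toContinuousLinearMap_le _
  have hconv := U.tendsto_birkhoffAverage_orthogonalProjection hUn (hq.toLp q)
  set P : Lp ℝ 2 μ := ((U.eqLocus (1 : Lp ℝ 2 μ →L[ℝ] Lp ℝ 2 μ)).orthogonalProjectionOnto
    (hq.toLp q) : Lp ℝ 2 μ) with hP
  have hPfix : U P = P := by
    have := ((U.eqLocus (1 : Lp ℝ 2 μ →L[ℝ] Lp ℝ 2 μ)).orthogonalProjectionOnto
      (hq.toLp q)).2
    exact this
  have hPae : (P : X → ℝ) ∘ T =ᵐ[μ] P := by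
    have h1 := Lp.coeFn_compMeasurePreserving (p := 2) P hmp
    have h2 : Lp.compMeasurePreserving T hmp P = P := hPfix
    rw [h2] at h1
    exact h1.symm
  obtain ⟨c, hc⟩ := hT.ae_eq_const_of_ae_eq_comp_ae (Lp.aestronglyMeasurable P) hPae
  have hB : ∀ N : ℕ, ((birkhoffAverage ℝ U _root_.id N (hq.toLp q) : Lp ℝ 2 μ) : X → ℝ) =ᵐ[μ]
      fun x => (N : ℝ)⁻¹ * ∑ n ∈ Finset.range N, q (T^[n] x) := by
    intro N
    unfold birkhoffAverage birkhoffSum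
    simp only [id_eq]
    have h1 := Lp.coeFn_smul ((N : ℝ)⁻¹) (∑ n ∈ Finset.range N, U^[n] (hq.toLp q))
    have h2 := Lp.coeFn_fun_finsetSum (Finset.range N) (fun n => U^[n] (hq.toLp q))
    have h3 : ∀ᵐ x ∂μ, ∀ n, (U^[n] (hq.toLp q) : X → ℝ) x = q (T^[n] x) :=
      ae_all_iff.2 fun n => koopman_iter_coe hmp hq n
    filter_upwards [h1, h2, h3] with x h1 h2 h3
    rw [h1, Pi.smul_apply, h2, smul_eq_mul]
    simp only [h3]
  have hmeas : ∀ n, Measurable fun x => q (T^[n] x) := fun n =>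
    hqm.comp (hmp.measurable.iterate n)
  have hint : ∀ n, Integrable (fun x => q (T^[n] x)) μ := fun n =>
    Integrable.of_bound (hmeas n).aestronglyMeasurable 1 (Eventually.of_forall fun x => hq1 _)
  have hl : Tendsto (fun N : ℕ => ∫ x, |(N : ℝ)⁻¹ * ∑ n ∈ Finset.range N, q (T^[n] x) - c| ∂μ)
      atTop (𝓝 0) := by
    have h0 := (tendsto_iff_norm_sub_tendsto_zero.1 hconv)
    refine squeeze_zero (fun N => integral_nonneg fun x => abs_nonneg _) (fun N => ?_) h0
    refine le_trans (le_of_eq ?_) (int_abs_le_norm _)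
    apply integral_congr_ae
    filter_upwards [hB N, hc, Lp.coeFn_sub (birkhoffAverage ℝ U _root_.id N (hq.toLp q)) P]
      with x h1 h2 h3
    rw [h3, Pi.sub_apply, h1, h2]
    rfl
  have hcq : c = ∫ y, q y ∂μ := by
    have hI : ∀ N : ℕ, 0 < N →
        ∫ x, ((N : ℝ)⁻¹ * ∑ n ∈ Finset.range N, q (T^[n] x) - c) ∂μ = (∫ y, q y ∂μ) - c := by
      intro N hN
      rw [integral_sub ((integrable_finset_sum _ fun n _ => hint n).const_mul _)
        (integrable_const c), integral_const_mul, integral_finset_sum _ (fun n _ => hint n)]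
      have : ∀ n, ∫ x, q (T^[n] x) ∂μ = ∫ y, q y ∂μ := fun n => by
        have := (hmp.iterate n)
        rw [← integral_map (φ := T^[n]) this.measurable.aemeasurable
          (by rw [this.map_eq]; exact hqm.aestronglyMeasurable), this.map_eq]
      have hN' : (N : ℝ) ≠ 0 := by exact_mod_cast hN.ne'
      simp only [this, Finset.sum_const, Finset.card_range, nsmul_eq_mul]
      rw [inv_mul_cancel_left₀ hN']; simp
    have h2 : Tendsto (fun N : ℕ => |(∫ y, q y ∂μ) - c|) atTop (𝓝 0) := by
      refine squeeze_zero' (Eventually.of_forall fun N => abs_nonneg _) ?_ hl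
      filter_upwards [eventually_gt_atTop 0] with N hN
      rw [← hI N hN]
      exact abs_integral_le_integral_abs
    have := tendsto_nhds_unique h2 tendsto_const_nhds
    have := abs_eq_zero.1 this.symm
    linarith
  rw [← hcq]; exact hl

lemma integrable_of_meas_bdd {Y : Type*} [MeasurableSpace Y] {m : Measure Y} [IsFiniteMeasure m]
    {f : Y → ℝ} (hf : Measurable f) {B : ℝ} (hb : ∀ y, |f y| ≤ B) : Integrable f m :=
  Integrable.of_bound hf.aestronglyMeasurable B (Eventually.of_forall hb)

lemma meas_int_left {X Y : Type*} [MeasurableSpace X] [MeasurableSpace Y] {f : X × Y → ℝ}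
    (hf : Measurable f) (m : Measure X) [SFinite m] : Measurable fun y => ∫ x, f (x, y) ∂m :=
  (hf.stronglyMeasurable.integral_prod_left').measurable

lemma abs_setIntegral_le_one {Y : Type*} [MeasurableSpace Y] {m : Measure Y}
    [IsProbabilityMeasure m] {f : Y → ℝ} (hb : ∀ y, |f y| ≤ 1) (C : Set Y) :
    |∫ y in C, f y ∂m| ≤ 1 := by
  have := norm_setIntegral_le_of_norm_le_const (μ := m) (s := C) (f := f) (C := 1)
    (measure_lt_top _ _) (fun x _ => hb x)
  refine this.trans ?_
  rw [one_mul]; exact measureReal_le_one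

lemma int_le_smul {X : Type*} [MeasurableSpace X] {μ ν : Measure X} [IsFiniteMeasure μ]
    {ℓ : ℕ} (hν : ν ≤ (ℓ : ENNReal) • μ) {f : X → ℝ} (hf : Measurable f) (h0 : ∀ x, 0 ≤ f x)
    {B : ℝ} (hB : ∀ x, f x ≤ B) : ∫ x, f x ∂ν ≤ ℓ * ∫ x, f x ∂μ := by
  have hi : Integrable f μ := integrable_of_meas_bdd hf (B := B) (fun y => by
    rw [abs_of_nonneg (h0 y)]; exact hB y)
  have h := integral_mono_measure (f := f) hν (Eventually.of_forall h0)
    (hi.smul_measure (ENNReal.natCast_ne_top ℓ))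
  rw [integral_smul_measure] at h
  simpa using h

lemma cesaro_e {X : Type*} [MeasurableSpace X] {μ ν : Measure X} [IsProbabilityMeasure μ]
    [IsProbabilityMeasure ν] {T : X → X} (hT : Ergodic T μ) {ℓ : ℕ}
    (hν : ν ≤ (ℓ : ENNReal) • μ) {p : X × X → ℝ} (hp : Measurable p) (h0 : ∀ z, 0 ≤ p z)
    (h1 : ∀ z, p z ≤ 1) {d : ℝ} (hd : ∀ᵐ y ∂ν, ∫ x, p (x, y) ∂μ = d) (C : Set X) :
    Tendsto (fun N : ℕ => (N : ℝ)⁻¹ * ∑ u ∈ Finset.range N,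
      ∫ y in C, ∫ x in C, p (T^[u] x, y) ∂ν ∂ν) atTop (𝓝 (ν.real C * (ν.real C * d))) := by
  have hTm : ∀ u, Measurable (T^[u]) := fun u => hT.measurable.iterate u
  have habs : ∀ z, |p z| ≤ 1 := fun z => by rw [abs_of_nonneg (h0 z)]; exact h1 z
  have hpu : ∀ u, Measurable fun z : X × X => p (T^[u] z.1, z.2) := fun u =>
    hp.comp (((hTm u).comp measurable_fst).prodMk measurable_snd)
  have hpy : ∀ y u, Measurable fun x : X => p (T^[u] x, y) := fun y u =>
    hp.comp ((hTm u).prodMk measurable_const)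
  have hpy0 : ∀ y, Measurable fun x : X => p (x, y) := fun y => hpy y 0
  let A : ℕ → X → X → ℝ := fun N y x => (N : ℝ)⁻¹ * ∑ u ∈ Finset.range N, p (T^[u] x, y)
  have hA0 : ∀ N y x, 0 ≤ A N y x := fun N y x =>
    mul_nonneg (by positivity) (Finset.sum_nonneg fun u _ => h0 _)
  have hA1 : ∀ N y x, A N y x ≤ 1 := by
    intro N y x
    rcases Nat.eq_zero_or_pos N with rfl | hN
    · simp [A]
    · have hN' : (0 : ℝ) < N := by exact_mod_cast hN
      simp only [A]
      rw [inv_mul_le_iff₀ hN', mul_one]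
      calc _ ≤ ∑ u ∈ Finset.range N, (1 : ℝ) := Finset.sum_le_sum fun u _ => h1 _
        _ = N := by simp
  have hAabs : ∀ N y x, |A N y x| ≤ 1 := fun N y x => by
    rw [abs_of_nonneg (hA0 N y x)]; exact hA1 N y x
  have hAm : ∀ N, Measurable fun z : X × X => A N z.2 z.1 := fun N =>
    (Finset.measurable_fun_sum _ fun u _ => hpu u).const_mul _
  have hAmy : ∀ N y, Measurable fun x : X => A N y x := fun N y =>
    (Finset.measurable_fun_sum _ fun u _ => hpy y u).const_mul _
  have heq : ∀ N : ℕ, (N : ℝ)⁻¹ * ∑ u ∈ Finset.range N,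
      ∫ y in C, ∫ x in C, p (T^[u] x, y) ∂ν ∂ν = ∫ y in C, ∫ x in C, A N y x ∂ν ∂ν := by
    intro N
    simp only [A]
    have e1 : ∀ y, ∫ x in C, (N : ℝ)⁻¹ * ∑ u ∈ Finset.range N, p (T^[u] x, y) ∂ν
        = (N : ℝ)⁻¹ * ∑ u ∈ Finset.range N, ∫ x in C, p (T^[u] x, y) ∂ν := by
      intro y
      rw [integral_const_mul, integral_finsetSum]
      intro u _
      exact integrable_of_meas_bdd (hpy y u) (fun x => habs _)
    simp only [e1]
    rw [integral_const_mul, integral_finsetSum]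
    intro u _
    exact integrable_of_meas_bdd (meas_int_left (hpu u) (ν.restrict C))
      (fun y => abs_setIntegral_le_one (fun x => habs _) C)
  simp only [heq]
  have hconst : ∫ _y in C, (ν.real C * d) ∂ν = ν.real C * (ν.real C * d) := by simp
  rw [← hconst]
  apply tendsto_integral_of_dominated_convergence (fun _ => (1 : ℝ))
  · intro N
    exact (meas_int_left (hAm N) (ν.restrict C)).aestronglyMeasurable
  · exact integrable_const _
  · intro N
    exact Eventually.of_forall fun y => abs_setIntegral_le_one (fun x => hAabs N y x) C
  · apply ae_restrict_of_ae
    filter_upwards [hd] with y hy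
    have hm := mean_ergodic hT (hpy0 y) (fun x => habs _)
    rw [hy] at hm
    have hd1 : |d| ≤ 1 := by
      rw [← hy]
      have := abs_setIntegral_le_one (m := μ) (fun x => habs (x, y)) Set.univ
      simpa using this
    rw [tendsto_iff_norm_sub_tendsto_zero]
    have hm2 := hm.const_mul (ℓ : ℝ)
    rw [mul_zero] at hm2
    refine squeeze_zero (fun _ => norm_nonneg _) (fun N => ?_) hm2
    have hi : Integrable (fun x => A N y x) ν := integrable_of_meas_bdd (hAmy N y) (hAabs N y)
    have e2 : ∫ x in C, A N y x ∂ν - ν.real C * d = ∫ x in C, (A N y x - d) ∂ν := by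
      rw [integral_sub hi.restrict (integrable_const _)]; simp
    rw [e2]
    have hmeas : Measurable fun x => |A N y x - d| := ((hAmy N y).sub_const d).abs
    have hb2 : ∀ x, |A N y x - d| ≤ 2 := fun x => by
      have := abs_sub (A N y x) d
      have := hAabs N y x
      linarith
    calc ‖∫ x in C, (A N y x - d) ∂ν‖ ≤ ∫ x in C, |A N y x - d| ∂ν :=
          norm_integral_le_integral_norm _
      _ ≤ ∫ x, |A N y x - d| ∂ν := by
          apply setIntegral_le_integral
          · exact integrable_of_meas_bdd hmeas (fun x => by rw [abs_abs]; exact hb2 x)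
          · exact Eventually.of_forall fun x => abs_nonneg _
      _ ≤ _ := int_le_smul hν hmeas (fun x => abs_nonneg _) hb2

/-- Existence of a good time `t`. -/
lemma exists_good_time {X : Type*} [MeasurableSpace X] {μ ν : Measure X} [IsProbabilityMeasure μ]
    [IsProbabilityMeasure ν] {T : X → X} (hT : Ergodic T μ) {ℓ : ℕ}
    (hν : ν ≤ (ℓ : ENNReal) • μ) {p : X × X → ℝ} (hp : Measurable p) (h0 : ∀ z, 0 ≤ p z)
    (h1 : ∀ z, p z ≤ 1) {d : ℝ} (hd : ∀ᵐ y ∂ν, ∫ x, p (x, y) ∂μ = d) (hd0 : 0 ≤ d)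
    (J : Finset ℕ) (C : ℕ → Set X)
    (hC : ∀ j, MeasurableSet (C j)) (hdisj : Pairwise (Function.onFun Disjoint C))
    (k : ℕ) (hk : 0 < k) {ε : ℝ} (hε : 0 < ε) :
    ∃ t : ℕ, ∑ j ∈ J, (ν.real (C j))⁻¹ * ∫ y in C j, ∫ x in C j, p (T^[k * t] x, y) ∂ν ∂ν
      ≤ k * d + ε := by
  let e : ℕ → ℕ → ℝ := fun j u => ∫ y in C j, ∫ x in C j, p (T^[u] x, y) ∂ν ∂ν
  have he0 : ∀ j u, 0 ≤ e j u := fun j u =>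
    integral_nonneg fun y => integral_nonneg fun x => h0 _
  have hlim : Tendsto (fun N : ℕ => (k : ℝ) * ∑ j ∈ J, (ν.real (C j))⁻¹ *
      ((N : ℝ)⁻¹ * ∑ u ∈ Finset.range N, e j u)) atTop
      (𝓝 ((k : ℝ) * ∑ j ∈ J, (ν.real (C j))⁻¹ * (ν.real (C j) * (ν.real (C j) * d)))) := by
    apply Tendsto.const_mul
    apply tendsto_finset_sum
    intro j _
    exact (cesaro_e hT hν hp h0 h1 hd (C j)).const_mul _
  have hle : (k : ℝ) * ∑ j ∈ J, (ν.real (C j))⁻¹ * (ν.real (C j) * (ν.real (C j) * d)) ≤ k * d := by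
    apply mul_le_mul_of_nonneg_left _ (Nat.cast_nonneg k)
    have : ∑ j ∈ J, (ν.real (C j))⁻¹ * (ν.real (C j) * (ν.real (C j) * d))
        ≤ ∑ j ∈ J, ν.real (C j) * d := by
      apply Finset.sum_le_sum
      intro j _
      by_cases hz : ν.real (C j) = 0
      · simp [hz]
      · rw [inv_mul_cancel_left₀ hz]
    refine this.trans ?_
    rw [← Finset.sum_mul]
    have h2 : ∑ j ∈ J, ν.real (C j) ≤ 1 := by
      rw [← measureReal_biUnion_finset (fun i _ j _ h => hdisj h) (fun j _ => hC j)]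
      exact measureReal_le_one
    nlinarith
  have hkt : Tendsto (fun M : ℕ => k * M) atTop atTop := Filter.tendsto_id.const_mul_atTop' hk
  have hev := ((hlim.comp hkt).eventually (gt_mem_nhds (lt_of_le_of_lt hle
    (lt_add_of_pos_right _ hε)))).and (eventually_gt_atTop 0)
  obtain ⟨M, hM, hM0⟩ := hev.exists
  by_contra hcon
  push Not at hcon
  have hM' : (0 : ℝ) < M := by exact_mod_cast hM0
  have hk' : (0 : ℝ) < k := by exact_mod_cast hk
  have hsum : ∑ t ∈ Finset.range M, (k * d + ε) ≤
      ∑ t ∈ Finset.range M, ∑ j ∈ J, (ν.real (C j))⁻¹ * e j (k * t) :=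
    Finset.sum_le_sum fun t _ => (hcon t).le
  have hsum2 : ∑ t ∈ Finset.range M, ∑ j ∈ J, (ν.real (C j))⁻¹ * e j (k * t) ≤
      ∑ j ∈ J, (ν.real (C j))⁻¹ * ∑ u ∈ Finset.range (k * M), e j u := by
    rw [Finset.sum_comm]
    apply Finset.sum_le_sum
    intro j _
    rw [← Finset.mul_sum]
    apply mul_le_mul_of_nonneg_left _ (inv_nonneg.2 measureReal_nonneg)
    have hinj : Function.Injective (fun t : ℕ => k * t) := fun a b h =>
      Nat.eq_of_mul_eq_mul_left hk h
    rw [← Finset.sum_image (f := e j) (g := fun t => k * t) (fun a _ b _ h => hinj h)]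
    apply Finset.sum_le_sum_of_subset_of_nonneg
    · intro u hu
      obtain ⟨t, ht, rfl⟩ := Finset.mem_image.1 hu
      rw [Finset.mem_range] at ht ⊢
      exact Nat.mul_lt_mul_of_pos_left ht hk
    · intro u _ _
      exact he0 j u
  have h3 : (k : ℝ) * ∑ j ∈ J, (ν.real (C j))⁻¹ *
      (((k * M : ℕ) : ℝ)⁻¹ * ∑ u ∈ Finset.range (k * M), e j u)
      = (M : ℝ)⁻¹ * ∑ j ∈ J, (ν.real (C j))⁻¹ * ∑ u ∈ Finset.range (k * M), e j u := by
    rw [Finset.mul_sum, Finset.mul_sum]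
    apply Finset.sum_congr rfl
    intro j _
    push_cast
    field_simp
  simp only [Function.comp] at hM
  rw [h3, inv_mul_lt_iff₀ hM'] at hM
  have h4 : ∑ t ∈ Finset.range M, (k * d + ε) = M * (k * d + ε) := by simp [mul_add]
  linarith

/-- Partition into sets on which `y ↦ K(·,y)` nearly constant in `L¹`. -/
lemma exists_partition {X : Type*} [MetricSpace X] [CompactSpace X] [MeasurableSpace X]
    [BorelSpace X] (μ : Measure X) [IsProbabilityMeasure μ] {K : X × X → ℝ} (hK : Measurable K)
    (hb : ∀ z, |K z| ≤ 1) {η : ℝ} (hη : 0 < η) :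
    ∃ C : ℕ → Set X, (∀ j, MeasurableSet (C j)) ∧ Pairwise (Function.onFun Disjoint C) ∧
      (⋃ j, C j) = Set.univ ∧
      ∀ j, ∀ y ∈ C j, ∀ y' ∈ C j, ∫ x, |K (x, y) - K (x, y')| ∂μ ≤ η := by
  haveI : Fact ((1 : ENNReal) ≠ ⊤) := ⟨ENNReal.one_ne_top⟩
  let u : ℕ → Lp ℝ 1 μ := TopologicalSpace.denseSeq (Lp ℝ 1 μ)
  have hu : ∀ k, Measurable (u k : X → ℝ) := fun k => (Lp.stronglyMeasurable (u k)).measurable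
  have hKy : ∀ y, Measurable fun x => K (x, y) := fun y =>
    hK.comp (measurable_id.prodMk measurable_const)
  have hKi : ∀ y, Integrable (fun x => K (x, y)) μ := fun y =>
    integrable_of_meas_bdd (hKy y) (fun x => hb _)
  have hui : ∀ k, Integrable (u k : X → ℝ) μ := fun k => L1.integrable_coeFn (u k)
  let B : ℕ → Set X := fun k => {y | ∫ x, |K (x, y) - u k x| ∂μ < η / 2}
  have hB : ∀ k, MeasurableSet (B k) := fun k => by
    have : Measurable fun z : X × X => |K z - u k z.1| :=
      (hK.sub ((hu k).comp measurable_fst)).abs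
    exact measurableSet_lt (meas_int_left this μ) measurable_const
  have hcov : (⋃ k, B k) = Set.univ := by
    rw [Set.eq_univ_iff_forall]
    intro y
    obtain ⟨k, hk⟩ := (TopologicalSpace.denseRange_denseSeq (Lp ℝ 1 μ)).exists_dist_lt
      ((hKi y).toL1 _) (half_pos hη)
    rw [Set.mem_iUnion]
    refine ⟨k, ?_⟩
    rw [L1.dist_eq_integral_dist] at hk
    refine lt_of_eq_of_lt ?_ hk
    apply integral_congr_ae
    filter_upwards [(hKi y).coeFn_toL1] with x hx
    rw [hx, Real.dist_eq]
  refine ⟨disjointed B, fun j => MeasurableSet.disjointed hB j, disjoint_disjointed B,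
    by rw [iUnion_disjointed, hcov], ?_⟩
  intro j y hy y' hy'
  have h1 : ∫ x, |K (x, y) - u j x| ∂μ < η / 2 := disjointed_subset B j hy
  have h2 : ∫ x, |K (x, y') - u j x| ∂μ < η / 2 := disjointed_subset B j hy'
  have i1 := ((hKi y).sub (hui j)).abs
  have i2 := ((hKi y').sub (hui j)).abs
  have : ∫ x, |K (x, y) - K (x, y')| ∂μ ≤
      ∫ x, (|K (x, y) - u j x| + |K (x, y') - u j x|) ∂μ := by
    apply integral_mono_of_nonneg (Eventually.of_forall fun x => abs_nonneg _) (i1.add i2)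
    refine Eventually.of_forall fun x => ?_
    have := abs_sub (K (x, y) - u j x) (K (x, y') - u j x)
    simpa using this
  have h3 := integral_add i1 i2
  simp only [Pi.sub_apply] at h3
  linarith

lemma core_piece {X : Type*} [MeasurableSpace X] {ν : Measure X} [IsProbabilityMeasure ν]
    {q : X × X → ℝ} (hq : Measurable q) (h0 : ∀ z, 0 ≤ q z) (h1 : ∀ z, q z ≤ 1)
    {C D : Set X} (hC : MeasurableSet C) (hD : MeasurableSet D) {R η : ℝ} (hR : 0 < R)
    (hη : 0 ≤ η)
    (hG : ∀ᵐ y ∂ν, y ∈ D → ∫ x in D, q (x, y) ∂ν = 0)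
    (hosc : ∀ᵐ y ∂ν, ∀ᵐ y' ∂ν, y ∈ C → y' ∈ C →
      ∫ x in D, q (x, y) ∂ν ≤ ∫ x in D, q (x, y') ∂ν + η) :
    ν.real C * (ν.real (C ∩ D) * (1 - R * η)) -
      ν.real (C ∩ D) * ν.real (C ∩ {y | 0 < ∫ x in D, q (x, y) ∂ν ∧ ∫ x in D, q (x, y) ∂ν < R⁻¹})
      ≤ ∫ y in C, ∫ x in C ∩ D, (1 - q (x, y)) ∂ν ∂ν := by
  set G : X → ℝ := fun y => ∫ x in D, q (x, y) ∂ν with hGdef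
  have hGm : Measurable G := meas_int_left hq (ν.restrict D)
  set N : Set X := {y | 0 < G y ∧ G y < R⁻¹} with hN
  have hNm : MeasurableSet N :=
    (measurableSet_lt measurable_const hGm).inter (measurableSet_lt hGm measurable_const)
  have habs : ∀ z, |q z| ≤ 1 := fun z => by rw [abs_of_nonneg (h0 z)]; exact h1 z
  have hqy : ∀ y, Measurable fun x : X => q (x, y) := fun y => hq.comp (by fun_prop)
  have hpt : ∀ᵐ y ∂ν, y ∈ C → ν.real (C ∩ D) * (1 - R * η - N.indicator (fun _ => (1:ℝ)) y)
      ≤ ∫ x in C ∩ D, (1 - q (x, y)) ∂ν := by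
    by_cases hz : ν (C ∩ D) = 0
    · refine Eventually.of_forall fun y _ => ?_
      have : ν.real (C ∩ D) = 0 := by simp [Measure.real, hz]
      rw [this, zero_mul]
      exact integral_nonneg fun x => by simpa using h1 (x, y)
    · filter_upwards [hosc] with y hy hyC
      have hnn : 0 ≤ ∫ x in C ∩ D, (1 - q (x, y)) ∂ν :=
        integral_nonneg fun x => by simpa using h1 (x, y)
      obtain ⟨y', hy'1, hy'2, hy'3⟩ : ∃ y', y' ∈ C ∩ D ∧ (y' ∈ D → G y' = 0) ∧
          (y ∈ C → y' ∈ C → G y ≤ G y' + η) := by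
        by_contra hcon
        push Not at hcon
        apply hz
        have hae : ∀ᵐ y' ∂ν, y' ∉ C ∩ D := by
          filter_upwards [hG, hy] with y' ha hb hc
          have := hcon y' hc ha
          obtain ⟨h1, h2, h3⟩ := this
          exact absurd (hb h1 h2) (not_le.mpr h3)
        simpa [ae_iff] using hae
      have hGle : G y ≤ η := by
        have := hy'3 hyC hy'1.1
        rw [hy'2 hy'1.2] at this
        simpa using this
      have hG0 : 0 ≤ G y := integral_nonneg fun x => h0 _
      rcases hG0.eq_or_lt with hg | hg
      · have hle : ∫ x in C ∩ D, q (x, y) ∂ν ≤ G y := by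
          apply setIntegral_mono_set
          · exact (integrable_of_meas_bdd (hqy y) (fun x => habs _))
          · exact Eventually.of_forall fun x => h0 _
          · exact (Set.inter_subset_right).eventuallyLE
        rw [integral_sub (integrable_const _) (integrable_of_meas_bdd (hqy y) (fun x => habs _))]
        have hind : 0 ≤ N.indicator (fun _ => (1:ℝ)) y := Set.indicator_nonneg (by simp) y
        have hm : 0 ≤ ν.real (C ∩ D) := measureReal_nonneg
        simp only [integral_const, smul_eq_mul, mul_one, measureReal_restrict_apply_univ]
        nlinarith [mul_nonneg hR.le hη, mul_nonneg hm hind, mul_nonneg hm (mul_nonneg hR.le hη)]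
      · refine le_trans ?_ hnn
        apply mul_nonpos_of_nonneg_of_nonpos measureReal_nonneg
        by_cases hlt : G y < R⁻¹
        · have : y ∈ N := ⟨hg, hlt⟩
          rw [Set.indicator_of_mem this]
          nlinarith [mul_nonneg hR.le hη]
        · have hind : 0 ≤ N.indicator (fun _ => (1:ℝ)) y := Set.indicator_nonneg (by simp) y
          have : 1 ≤ R * η := by
            have h2 : R⁻¹ ≤ η := (not_lt.mp hlt).trans hGle
            rwa [inv_le_iff_one_le_mul₀' hR] at h2
          linarith
  have hindI : Integrable (N.indicator (fun _ => (1:ℝ))) (ν.restrict C) :=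
    (integrable_const (1:ℝ)).indicator hNm
  have hint : ∫ y in C, ν.real (C ∩ D) * (1 - R * η - N.indicator (fun _ => (1:ℝ)) y) ∂ν
      = ν.real C * (ν.real (C ∩ D) * (1 - R * η)) - ν.real (C ∩ D) * ν.real (C ∩ N) := by
    rw [integral_const_mul, integral_sub (integrable_const _) hindI, integral_indicator hNm]
    simp only [integral_const, smul_eq_mul, mul_one, measureReal_restrict_apply_univ,
      Measure.restrict_restrict hNm]
    rw [Set.inter_comm N C]
    ring
  rw [← hint]
  apply integral_mono_ae
  · exact ((integrable_const _).sub hindI).const_mul _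
  · have hm1 : Measurable fun z : X × X => 1 - q z := measurable_const.sub hq
    refine integrable_of_meas_bdd (B := 1) (meas_int_left hm1 (ν.restrict (C ∩ D))) (fun y => ?_)
    apply abs_setIntegral_le_one
    intro x
    rw [abs_of_nonneg (by simpa using h1 (x, y))]
    simpa using h0 (x, y)
  · rw [EventuallyLE, ae_restrict_iff' hC]
    exact hpt

lemma sum_inter_eq {X ι : Type*} [MeasurableSpace X] {ν : Measure X} [IsProbabilityMeasure ν]
    {C : ι → Set X} (hC : ∀ j, MeasurableSet (C j)) (hdisj : Pairwise (Function.onFun Disjoint C))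
    (J : Finset ι) {A : Set X} (hA : MeasurableSet A) :
    ∑ j ∈ J, ν.real (C j ∩ A) = ν.real ((⋃ j ∈ J, C j) ∩ A) := by
  rw [Set.iUnion₂_inter, measureReal_biUnion_finset]
  · intro i _ j _ hij
    exact (hdisj hij).mono Set.inter_subset_left Set.inter_subset_left
  · exact fun j _ => (hC j).inter hA

/-- Abstract lower bound. -/
lemma core_lower {X : Type*} [MeasurableSpace X] {ν : Measure X} [IsProbabilityMeasure ν]
    {q : X × X → ℝ} (hq : Measurable q) (h0 : ∀ z, 0 ≤ q z) (h1 : ∀ z, q z ≤ 1)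
    {C : ℕ → Set X} (hC : ∀ j, MeasurableSet (C j))
    (hdisj : Pairwise (Function.onFun Disjoint C)) (J : Finset ℕ)
    {n : ℕ} {D : Fin n → Set X} (hD : ∀ i, MeasurableSet (D i))
    (hDdisj : Pairwise (Function.onFun Disjoint D)) {R η δ : ℝ} (hR : 0 < R)
    (hη : 0 ≤ η)
    (hδ : ∀ i, ν.real {y | 0 < ∫ x in D i, q (x, y) ∂ν ∧ ∫ x in D i, q (x, y) ∂ν < R⁻¹} ≤ δ)
    (hG : ∀ i, ∀ᵐ y ∂ν, y ∈ D i → ∫ x in D i, q (x, y) ∂ν = 0)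
    (hosc : ∀ i j, ∀ᵐ y ∂ν, ∀ᵐ y' ∂ν, y ∈ C j → y' ∈ C j →
      ∫ x in D i, q (x, y) ∂ν ≤ ∫ x in D i, q (x, y') ∂ν + η) :
    ν.real (⋃ i, D i) - ν.real (⋃ j ∈ J, C j)ᶜ - n * (R * η + δ) ≤
      ∑ j ∈ J, (ν.real (C j))⁻¹ * ∫ y in C j, ∫ x in C j, (1 - q (x, y)) ∂ν ∂ν := by
  set N : Fin n → Set X := fun i =>
    {y | 0 < ∫ x in D i, q (x, y) ∂ν ∧ ∫ x in D i, q (x, y) ∂ν < R⁻¹} with hN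
  have hGm : ∀ i, Measurable fun y => ∫ x in D i, q (x, y) ∂ν :=
    fun i => meas_int_left hq (ν.restrict (D i))
  have hNm : ∀ i, MeasurableSet (N i) := fun i =>
    (measurableSet_lt measurable_const (hGm i)).inter (measurableSet_lt (hGm i) measurable_const)
  have hm1 : Measurable fun z : X × X => 1 - q z := measurable_const.sub hq
  have hb1 : ∀ z, |1 - q z| ≤ 1 := fun z => by
    rw [abs_of_nonneg (by simpa using h1 z)]
    simpa using h0 z
  have hn1 : ∀ z, 0 ≤ 1 - q z := fun z => by simpa using h1 z
  have hj : ∀ j, ∑ i, (ν.real (C j ∩ D i) * (1 - R * η) - ν.real (C j ∩ N i)) ≤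
      (ν.real (C j))⁻¹ * ∫ y in C j, ∫ x in C j, (1 - q (x, y)) ∂ν ∂ν := by
    intro j
    by_cases hz : ν.real (C j) = 0
    · have e : ∀ A, ν.real (C j ∩ A) = 0 := fun A =>
        le_antisymm (hz ▸ measureReal_mono Set.inter_subset_left) measureReal_nonneg
      simp [e, hz]
    · have hpos : 0 < ν.real (C j) := lt_of_le_of_ne measureReal_nonneg (Ne.symm hz)
      rw [← div_eq_inv_mul, le_div_iff₀ hpos, Finset.sum_mul]
      have hI : ∀ A, Integrable (fun y => ∫ x in A, (1 - q (x, y)) ∂ν) (ν.restrict (C j)) :=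
        fun A => integrable_of_meas_bdd (B := 1) (meas_int_left hm1 (ν.restrict A))
          (fun y => abs_setIntegral_le_one (fun x => hb1 (x, y)) A)
      calc _ ≤ ∑ i, ∫ y in C j, ∫ x in C j ∩ D i, (1 - q (x, y)) ∂ν ∂ν := by
            apply Finset.sum_le_sum
            intro i _
            refine le_trans ?_ (core_piece hq h0 h1 (hC j) (hD i) hR hη (hG i) (hosc i j))
            have : ν.real (C j ∩ D i) ≤ ν.real (C j) := measureReal_mono Set.inter_subset_left
            have h3 : 0 ≤ ν.real (C j ∩ N i) := measureReal_nonneg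
            change _ ≤ _ - ν.real (C j ∩ D i) * ν.real (C j ∩ N i)
            nlinarith [mul_le_mul_of_nonneg_right this h3]
        _ = ∫ y in C j, ∑ i, ∫ x in C j ∩ D i, (1 - q (x, y)) ∂ν ∂ν := by
            rw [integral_finsetSum]
            exact fun i _ => hI _
        _ ≤ _ := by
            apply integral_mono (integrable_finsetSum _ fun i _ => hI _) (hI _)
            intro y
            have hIy : Integrable (fun x => 1 - q (x, y)) ν :=
              integrable_of_meas_bdd (B := 1) (hm1.comp (by fun_prop)) (fun x => hb1 _)
            simp only
            rw [← integral_iUnion_fintype]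
            · apply setIntegral_mono_set hIy.integrableOn
              · exact Eventually.of_forall fun x => hn1 _
              · exact (Set.iUnion_subset fun i => Set.inter_subset_left).eventuallyLE
            · exact fun i => (hC j).inter (hD i)
            · intro a b hab
              exact (hDdisj hab).mono Set.inter_subset_right Set.inter_subset_right
            · exact fun i => hIy.integrableOn
  refine le_trans ?_ (Finset.sum_le_sum fun j _ => hj j)
  rw [Finset.sum_comm]
  have hi : ∀ i, ν.real ((⋃ j ∈ J, C j) ∩ D i) - (R * η + δ) ≤
      ∑ j ∈ J, (ν.real (C j ∩ D i) * (1 - R * η) - ν.real (C j ∩ N i)) := by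
    intro i
    rw [Finset.sum_sub_distrib, ← Finset.sum_mul, sum_inter_eq hC hdisj J (hD i),
      sum_inter_eq hC hdisj J (hNm i)]
    have a1 : ν.real ((⋃ j ∈ J, C j) ∩ N i) ≤ δ :=
      (measureReal_mono Set.inter_subset_right).trans (hδ i)
    have a2 : ν.real ((⋃ j ∈ J, C j) ∩ D i) ≤ 1 := measureReal_le_one
    nlinarith [mul_nonneg hR.le hη]
  refine le_trans ?_ (Finset.sum_le_sum fun i _ => hi i)
  rw [Finset.sum_sub_distrib]
  have e1 : ∑ i, ν.real ((⋃ j ∈ J, C j) ∩ D i) = ν.real ((⋃ i, D i) ∩ ⋃ j ∈ J, C j) := by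
    have := sum_inter_eq (ν := ν) hD hDdisj Finset.univ
      (A := ⋃ j ∈ J, C j) (Finset.measurableSet_biUnion _ fun j _ => hC j)
    simp only [Set.inter_comm (⋃ j ∈ J, C j)]
    simpa using this
  rw [e1]
  have e2 : ν.real (⋃ i, D i) ≤ ν.real ((⋃ i, D i) ∩ ⋃ j ∈ J, C j) + ν.real (⋃ j ∈ J, C j)ᶜ := by
    refine le_trans (measureReal_mono ?_) (measureReal_union_le _ _)
    intro x hx
    by_cases h : x ∈ ⋃ j ∈ J, C j
    · exact Or.inl ⟨hx, h⟩
    · exact Or.inr h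
  simp only [Finset.sum_const, Finset.card_univ, Fintype.card_fin, nsmul_eq_mul]
  linarith

lemma iter_rel {X : Type*} [MeasurableSpace X] {μ ν : Measure X} [IsProbabilityMeasure μ]
    [IsProbabilityMeasure ν] {T : X → X} (hT : MeasurePreserving T μ μ) {ℓ m : ℕ}
    (hS : MeasurePreserving (T^[ℓ]) ν ν) {K : X × X → ℝ}
    (hc : ∀ᵐ z ∂(μ.prod ν), K (z.1, T^[ℓ] z.2) = K (T^[m] z.1, z.2)) (t : ℕ) :
    ∀ᵐ z ∂(μ.prod ν), K (z.1, T^[ℓ * t] z.2) = K (T^[m * t] z.1, z.2) := by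
  induction t with
  | zero => simp
  | succ t ih =>
    have hSt : MeasurePreserving (T^[ℓ * t]) ν ν := by
      rw [Function.iterate_mul]; exact hS.iterate t
    have q1 := ((MeasurePreserving.id μ).prod hSt).quasiMeasurePreserving.ae hc
    have q2 := (((hT.iterate m)).prod (MeasurePreserving.id ν)).quasiMeasurePreserving.ae ih
    filter_upwards [q1, q2] with z h1 h2
    simp only [Prod.map, id] at h1 h2
    rw [show ℓ * (t + 1) = ℓ + ℓ * t by ring, show m * (t + 1) = m * t + m by ring,
      Function.iterate_add_apply, h1, h2, Function.iterate_add_apply]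

lemma iter_rel' {X : Type*} [MeasurableSpace X] {μ ν : Measure X} [IsProbabilityMeasure μ]
    [IsProbabilityMeasure ν] {T : X → X} (hT : MeasurePreserving T μ μ) {ℓ m : ℕ}
    (hS : MeasurePreserving (T^[ℓ]) ν ν) {K : X × X → ℝ} (hK : Measurable K)
    (hc : ∀ᵐ z ∂(μ.prod ν), K (z.1, T^[ℓ] z.2) = K (T^[m] z.1, z.2)) (t : ℕ) :
    ∀ᵐ y ∂ν, ∀ᵐ x ∂μ, K (x, T^[ℓ * t] y) = K (T^[m * t] x, y) := by
  have h := iter_rel hT hS hc t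
  have h2 := (Measure.measurePreserving_swap (μ := ν) (ν := μ)).quasiMeasurePreserving.ae h
  exact Measure.ae_ae_of_ae_prod h2

lemma exists_small {X : Type*} [MeasurableSpace X] {ν : Measure X} [IsProbabilityMeasure ν]
    {g : X → ℝ} (hg : Measurable g) {ε : ℝ} (hε : 0 < ε) :
    ∀ᶠ r : ℕ in atTop, ν.real {y | 0 < g y ∧ g y < ((r : ℝ) + 1)⁻¹} ≤ ε := by
  have ht : Tendsto (fun r : ℕ => ν {y | 0 < g y ∧ g y < ((r : ℝ) + 1)⁻¹}) atTop
      (𝓝 (ν (⋂ r : ℕ, {y | 0 < g y ∧ g y < ((r : ℝ) + 1)⁻¹}))) := by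
    apply tendsto_measure_iInter_atTop
    · intro r
      exact ((measurableSet_lt measurable_const hg).inter
        (measurableSet_lt hg measurable_const)).nullMeasurableSet
    · intro r s hrs y hy
      refine ⟨hy.1, hy.2.trans_le ?_⟩
      have : (r : ℝ) ≤ s := by exact_mod_cast hrs
      gcongr
    · exact ⟨0, measure_ne_top _ _⟩
  have he : (⋂ r : ℕ, {y | 0 < g y ∧ g y < ((r : ℝ) + 1)⁻¹}) = ∅ := by
    ext y
    simp only [Set.mem_iInter, Set.mem_setOf_eq, Set.mem_empty_iff_false, iff_false]
    intro h
    obtain ⟨r, hr⟩ := exists_nat_one_div_lt (h 0).1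
    have := (h r).2
    rw [one_div] at hr
    linarith
  rw [he, measure_empty] at ht
  have ht2 := (ENNReal.tendsto_toReal (by simp)).comp ht
  simp only [ENNReal.toReal_zero] at ht2
  exact (ht2.eventually (gt_mem_nhds hε)).mono fun r hr => le_of_lt hr

lemma exists_finite_cover {X : Type*} [MeasurableSpace X] {ν : Measure X} [IsProbabilityMeasure ν]
    {C : ℕ → Set X} (hC : ∀ j, MeasurableSet (C j)) 
    (hU : (⋃ j, C j) = Set.univ) {ε : ℝ} (hε : 0 < ε) :
    ∃ J : Finset ℕ, ν.real (⋃ j ∈ J, C j)ᶜ ≤ ε := by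
  have ht : Tendsto (fun r : ℕ => ν (⋃ j ∈ Finset.range r, C j)ᶜ) atTop
      (𝓝 (ν (⋂ r : ℕ, (⋃ j ∈ Finset.range r, C j)ᶜ))) := by
    apply tendsto_measure_iInter_atTop
    · intro r
      exact (Finset.measurableSet_biUnion _ fun j _ => hC j).compl.nullMeasurableSet
    · intro r s hrs
      apply Set.compl_subset_compl.mpr
      apply Set.biUnion_subset_biUnion_left
      intro j hj
      simp only [Finset.coe_range, Set.mem_Iio] at hj ⊢
      exact lt_of_lt_of_le hj hrs
    · exact ⟨0, measure_ne_top _ _⟩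
  have he : (⋂ r : ℕ, (⋃ j ∈ Finset.range r, C j)ᶜ) = ∅ := by
    rw [← Set.compl_iUnion, Set.compl_empty_iff, Set.eq_univ_iff_forall]
    intro x
    have hx : x ∈ ⋃ j, C j := by rw [hU]; trivial
    obtain ⟨j, hj⟩ := Set.mem_iUnion.mp hx
    exact Set.mem_iUnion.mpr ⟨j + 1, Set.mem_biUnion (Finset.self_mem_range_succ j) hj⟩
  rw [he, measure_empty] at ht
  have ht2 := (ENNReal.tendsto_toReal (by simp)).comp ht
  simp only [ENNReal.toReal_zero] at ht2
  obtain ⟨r, hr⟩ := (ht2.eventually (gt_mem_nhds hε)).exists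
  exact ⟨Finset.range r, le_of_lt hr⟩

/-- Core inequality. -/
lemma core {X : Type*} [MetricSpace X] [CompactSpace X] [MeasurableSpace X]
    [BorelSpace X] {μ ν : Measure X} [IsProbabilityMeasure μ] [IsProbabilityMeasure ν]
    {T : X → X} (hT : Ergodic T μ) {ℓ m : ℕ} (hℓ : 0 < ℓ)
    (hν : ν ≤ (ℓ : ENNReal) • μ) (hS : MeasurePreserving (T^[ℓ]) ν ν)
    {K : X × X → ℝ} (hK : Measurable K) (h0 : ∀ z, 0 ≤ K z) (h1 : ∀ z, K z ≤ 1) {c : ℝ}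
    (hc1 : c ≤ 1) (hb : ∀ᵐ y ∂ν, ∫ x, K (x, y) ∂μ = c)
    (hc : ∀ᵐ z ∂(μ.prod ν), K (z.1, T^[ℓ] z.2) = K (T^[m] z.1, z.2))
    {n : ℕ} {D : Fin n → Set X} (hD : ∀ i, MeasurableSet (D i))
    (hDdisj : Pairwise (Function.onFun Disjoint D))
    (hG : ∀ i, ∀ᵐ y ∂ν, y ∈ D i → ∫ x in D i, K (x, y) ∂ν = 0) :
    ν.real (⋃ i, D i) ≤ (ℓ + m : ℝ) * (1 - c) := by
  have habs : ∀ z, |K z| ≤ 1 := fun z => by rw [abs_of_nonneg (h0 z)]; exact h1 z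
  have hKy : ∀ y, Measurable fun x : X => K (x, y) := fun y => hK.comp (by fun_prop)
  have hac : ν ≪ μ := (Measure.absolutelyContinuous_of_le hν).trans
    Measure.smul_absolutelyContinuous
  suffices h : ∀ ε : ℝ, 0 < ε → ν.real (⋃ i, D i) ≤ (ℓ + m : ℝ) * (1 - c) + (2 * n + 2) * ε by
    apply le_of_forall_pos_le_add
    intro δ hδ
    have h2 : (0 : ℝ) < 2 * n + 2 := by positivity
    have := h (δ / (2 * n + 2)) (by positivity)
    rwa [mul_div_cancel₀ _ h2.ne'] at this
  intro ε hε
  obtain ⟨r, hr⟩ := (eventually_all.mpr fun i : Fin n =>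
    exists_small (ν := ν) (meas_int_left hK (ν.restrict (D i))) hε).exists
  set R : ℝ := (r : ℝ) + 1 with hRdef
  have hR : 0 < R := by positivity
  have hℓ' : (0 : ℝ) < ℓ := by exact_mod_cast hℓ
  obtain ⟨C, hCm, hCd, hCU, hCη⟩ := exists_partition μ hK habs (η := ε / (R * ℓ)) (by positivity)
  obtain ⟨J, hJ⟩ := exists_finite_cover (ν := ν) hCm hCU hε
  have hp : Measurable fun z : X × X => 1 - K z := measurable_const.sub hK
  have hd : ∀ᵐ y ∂ν, ∫ x, (1 - K (x, y)) ∂μ = 1 - c := by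
    filter_upwards [hb] with y hy
    rw [integral_sub (integrable_const _) (integrable_of_meas_bdd (hKy y) fun x => habs _), hy]
    simp
  obtain ⟨t, ht⟩ := exists_good_time hT hν hp (fun z => by simpa using h1 z)
    (fun z => by simpa using h0 z) hd (by linarith) J C hCm hCd (ℓ + m) (by omega) hε
  have hSt : MeasurePreserving (T^[ℓ * t]) ν ν := by
    rw [Function.iterate_mul]; exact hS.iterate t
  have hStμ : MeasurePreserving (T^[ℓ * t]) μ μ := hT.toMeasurePreserving.iterate _
  have hMtμ : MeasurePreserving (T^[m * t]) μ μ := hT.toMeasurePreserving.iterate _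
  have hrel := iter_rel' hT.toMeasurePreserving hS hK hc t
  let q : X × X → ℝ := fun z => K (T^[ℓ * t] z.1, T^[ℓ * t] z.2)
  have hq : Measurable q := hK.comp ((hSt.measurable.comp measurable_fst).prodMk
    (hSt.measurable.comp measurable_snd))
  have hrel2 : ∀ᵐ y ∂ν, ∀ᵐ x ∂ν, q (x, y) = K (T^[(ℓ + m) * t] x, y) := by
    filter_upwards [hrel] with y hy
    have := hac.ae_le (hStμ.quasiMeasurePreserving.ae hy)
    filter_upwards [this] with x hx
    simp only [q]
    rw [hx, ← Function.iterate_add_apply, ← add_mul, add_comm m ℓ]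
  have hsum : ∑ j ∈ J, (ν.real (C j))⁻¹ * ∫ y in C j, ∫ x in C j, (1 - q (x, y)) ∂ν ∂ν
      ≤ ((ℓ + m : ℕ) : ℝ) * (1 - c) + ε := by
    refine le_trans (le_of_eq ?_) ht
    apply Finset.sum_congr rfl
    intro j _
    congr 1
    apply integral_congr_ae
    apply ae_restrict_of_ae
    filter_upwards [hrel2] with y hy
    apply integral_congr_ae
    apply ae_restrict_of_ae
    filter_upwards [hy] with x hx
    rw [hx]
  let D' : Fin n → Set X := fun i => T^[ℓ * t] ⁻¹' D i
  have hGeq : ∀ i y, ∫ x in D' i, q (x, y) ∂ν = ∫ x in D i, K (x, T^[ℓ * t] y) ∂ν := by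
    intro i y
    have := setIntegral_map (μ := ν) (g := T^[ℓ * t]) (hD i)
      (f := fun x => K (x, T^[ℓ * t] y)) (hKy _).aestronglyMeasurable hSt.measurable.aemeasurable
    rw [hSt.map_eq] at this
    exact this.symm
  have hlow := core_lower (ν := ν) hq (fun z => h0 _) (fun z => h1 _) hCm hCd J (D := D')
    (fun i => hSt.measurable (hD i)) (fun i j hij => (hDdisj hij).preimage _) hR
    (η := ℓ * (ε / (R * ℓ))) (δ := ε) (by positivity) ?_ ?_ ?_
  · have e1 : ν.real (⋃ i, D' i) = ν.real (⋃ i, D i) := by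
      rw [← Set.preimage_iUnion]
      exact hSt.measureReal_preimage (MeasurableSet.iUnion hD).nullMeasurableSet
    rw [e1] at hlow
    have e2 : R * (ℓ * (ε / (R * ℓ))) = ε := by field_simp
    rw [e2] at hlow
    push_cast at hsum
    linarith
  · intro i
    simp only [hGeq]
    have hm : MeasurableSet {y | 0 < ∫ x in D i, K (x, y) ∂ν ∧ ∫ x in D i, K (x, y) ∂ν < R⁻¹} :=
      (measurableSet_lt measurable_const (meas_int_left hK (ν.restrict (D i)))).inter
        (measurableSet_lt (meas_int_left hK (ν.restrict (D i))) measurable_const)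
    have := hSt.measureReal_preimage hm.nullMeasurableSet
    exact (le_of_eq this).trans (hr i)
  · intro i
    have := hSt.quasiMeasurePreserving.ae (hG i)
    filter_upwards [this] with y hy hyD
    rw [hGeq]
    exact hy hyD
  · intro i j
    filter_upwards [hrel] with y hy
    filter_upwards [hrel] with y' hy' hyC hyC'
    rw [hGeq, hGeq]
    have hi : ∀ y, Integrable (fun x => K (x, y)) (ν.restrict (D i)) := fun y =>
      integrable_of_meas_bdd (hKy y) fun x => habs _
    have hdm : ∀ y y', Measurable fun x => |K (x, y) - K (x, y')| := fun y y' =>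
      ((hKy y).sub (hKy y')).abs
    have hd2 : ∀ y y' x, |K (x, y) - K (x, y')| ≤ 2 := fun y y' x => by
      rw [abs_le]
      constructor <;> linarith [h0 (x, y), h1 (x, y), h0 (x, y'), h1 (x, y')]
    have hdi : Integrable (fun x => |K (x, T^[ℓ * t] y) - K (x, T^[ℓ * t] y')|) ν :=
      integrable_of_meas_bdd (B := 2) (hdm _ _) fun x => by rw [abs_abs]; exact hd2 _ _ x
    have s1 : ∫ x in D i, K (x, T^[ℓ * t] y) ∂ν - ∫ x in D i, K (x, T^[ℓ * t] y') ∂ν ≤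
        ∫ x, |K (x, T^[ℓ * t] y) - K (x, T^[ℓ * t] y')| ∂ν := by
      rw [← integral_sub (hi _) (hi _)]
      calc _ ≤ ∫ x in D i, |K (x, T^[ℓ * t] y) - K (x, T^[ℓ * t] y')| ∂ν :=
            integral_mono ((hi _).sub (hi _)) hdi.restrict fun x => le_abs_self _
        _ ≤ _ := setIntegral_le_integral hdi (Eventually.of_forall fun x => abs_nonneg _)
    have s2 := int_le_smul hν (hdm (T^[ℓ * t] y) (T^[ℓ * t] y')) (fun x => abs_nonneg _)
      (hd2 _ _)
    have s3 : ∫ x, |K (x, T^[ℓ * t] y) - K (x, T^[ℓ * t] y')| ∂μ = ∫ x, |K (x, y) - K (x, y')| ∂μ := by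
      have : ∫ x, |K (x, T^[ℓ * t] y) - K (x, T^[ℓ * t] y')| ∂μ =
          ∫ x, |K (T^[m * t] x, y) - K (T^[m * t] x, y')| ∂μ := by
        apply integral_congr_ae
        filter_upwards [hy, hy'] with x hx hx'
        rw [hx, hx']
      rw [this]
      have h5 := integral_map (μ := μ) (φ := T^[m * t]) hMtμ.measurable.aemeasurable
        (f := fun x => |K (x, y) - K (x, y')|) (hdm y y').aestronglyMeasurable
      rw [hMtμ.map_eq] at h5
      exact h5.symm
    have s4 := hCη j y hyC y' hyC'
    rw [s3] at s2
    have s5 := mul_le_mul_of_nonneg_left s4 hℓ'.le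
    linarith

section measure_compare

variable {Y : Type*} [MetricSpace Y] [CompactSpace Y] [MeasurableSpace Y] [BorelSpace Y]

lemma cont_integrable (m : Measure Y) [IsFiniteMeasure m] (h : C(Y, ℝ)) : Integrable h m := by
  refine integrable_of_meas_bdd (B := ‖h‖) h.continuous.measurable fun y => ?_
  exact h.norm_coe_le_norm y

lemma isOpen_measure_le (m : Measure Y) [IsFiniteMeasure m] {U : Set Y} (hU : IsOpen U) {B : ℝ}
    (hB : ∀ h : C(Y, ℝ), (∀ y, 0 ≤ h y) → (∀ y, h y ≤ 1) → (∀ y, y ∉ U → h y = 0) →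
      ∫ y, h y ∂m ≤ B) : m U ≤ ENNReal.ofReal B := by
  by_contra hcon
  obtain ⟨K, hKU, hK, hlt⟩ := hU.exists_lt_isCompact (not_le.mp hcon)
  obtain ⟨h, h0, h1, h01⟩ := exists_continuous_zero_one_of_isClosed (s := Uᶜ) (t := K)
    hU.isClosed_compl hK.isClosed (Set.disjoint_compl_left_iff_subset.mpr hKU)
  have hle := hB h (fun y => (h01 y).1) (fun y => (h01 y).2) (fun y hy => h0 hy)
  have h2 : m.real K ≤ ∫ y, h y ∂m := by
    rw [← integral_indicator_one hK.measurableSet]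
    apply integral_mono ((integrable_const (1 : ℝ)).indicator hK.measurableSet)
      (cont_integrable m h)
    intro y
    by_cases hy : y ∈ K
    · simp only [Set.indicator_of_mem hy]
      rw [h1 hy]; exact le_rfl
    · simp only [Set.indicator_of_notMem hy]
      exact (h01 y).1
  have h3 : m K ≤ ENNReal.ofReal B := by
    rw [← ENNReal.ofReal_toReal (measure_ne_top m K)]
    exact ENNReal.ofReal_le_ofReal (h2.trans hle)
  exact absurd hlt (not_lt.mpr h3)

lemma measure_le_of_int (m₁ m₂ : Measure Y) [IsFiniteMeasure m₁] [IsFiniteMeasure m₂]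
    (h : ∀ h : C(Y, ℝ), (∀ y, 0 ≤ h y) → ∫ y, h y ∂m₁ ≤ ∫ y, h y ∂m₂) : m₁ ≤ m₂ := by
  have hopen : ∀ U, IsOpen U → m₁ U ≤ m₂ U := by
    intro U hU
    have := isOpen_measure_le m₁ hU (B := m₂.real U) ?_
    · rwa [Measure.real, ENNReal.ofReal_toReal (measure_ne_top _ _)] at this
    · intro f f0 f1 fU
      refine (h f f0).trans ?_
      rw [← integral_indicator_one hU.measurableSet]
      apply integral_mono (cont_integrable m₂ f)
        ((integrable_const (1 : ℝ)).indicator hU.measurableSet)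
      intro y
      by_cases hy : y ∈ U
      · simp only [Set.indicator_of_mem hy]
        exact f1 y
      · simp only [Set.indicator_of_notMem hy]
        exact (fU y hy).le
  rw [Measure.le_iff]
  intro A _
  rw [A.measure_eq_iInf_isOpen m₂]
  refine le_iInf fun U => le_iInf fun hAU => le_iInf fun hU => ?_
  exact (measure_mono hAU).trans (hopen U hU)

lemma measure_eq_of_int (m₁ m₂ : Measure Y) [IsFiniteMeasure m₁] [IsFiniteMeasure m₂]
    (h : ∀ h : C(Y, ℝ), ∫ y, h y ∂m₁ = ∫ y, h y ∂m₂) : m₁ = m₂ :=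
  le_antisymm (measure_le_of_int _ _ fun f _ => (h f).le)
    (measure_le_of_int _ _ fun f _ => (h f).ge)

end measure_compare

lemma bdd_cont {Y : Type*} [MetricSpace Y] [CompactSpace Y] (h : C(Y, ℝ)) (u : ℕ → Y) :
    BddSeq (fun n => h (u n)) := ⟨‖h‖, fun n => h.norm_coe_le_norm _⟩

lemma exists_nu {X : Type*} [MetricSpace X] [CompactSpace X] [MeasurableSpace X]
    [BorelSpace X] (T : X ≃ₜ X) (μ : Measure X) [IsProbabilityMeasure μ] (a : X)
    {M : (ℕ → ℝ) → ℝ} (hM : IsShiftMean M)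
    (hgen : ∀ f : C(X, ℝ), M (fun n => f (T^[n] a)) = ∫ x, f x ∂μ) {ℓ : ℕ} (hℓ : 0 < ℓ) :
    ∃ ν : Measure X, IsProbabilityMeasure ν ∧
      (∀ f : C(X, ℝ), ∫ x, f x ∂ν = divMean M ℓ (fun n => f (T^[ℓ * n] a))) ∧
      ν ≤ (ℓ : ENNReal) • μ ∧ MeasurePreserving (T^[ℓ]) ν ν := by
  have hM' := divMean_isShiftMean hM hℓ
  obtain ⟨ν, hfin, hν⟩ := exists_riesz (Y := X)
    (fun f => divMean M ℓ (fun n => f (T^[ℓ * n] a)))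
    (fun f g => hM'.add _ _ (bdd_cont f _) (bdd_cont g _))
    (fun c f => hM'.smul c _ (bdd_cont f _))
    (fun f hf => by
      have := hM'.mono (fun _ => 0) (fun n => f (T^[ℓ * n] a)) (bddSeq_const 0) (bdd_cont f _)
        (fun n => hf _)
      rwa [hM'.const] at this)
  have hprob : IsProbabilityMeasure ν := by
    have h1 := hν (ContinuousMap.const X 1)
    simp only [ContinuousMap.const_apply, hM'.one, integral_const, smul_eq_mul, mul_one] at h1
    constructor
    rw [← ENNReal.ofReal_toReal (measure_ne_top ν Set.univ)]
    change ENNReal.ofReal (ν.real Set.univ) = 1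
    rw [h1]; simp
  have hsfin : IsFiniteMeasure ((ℓ : ENNReal) • μ) :=
    ⟨by simp⟩
  have hcont : Continuous (T^[ℓ]) := T.continuous.iterate ℓ
  refine ⟨ν, hprob, hν, ?_, hcont.measurable, ?_⟩
  · apply measure_le_of_int
    intro h h0
    rw [hν, integral_smul_measure, ← hgen]
    simp only [divMean, ENNReal.toReal_natCast, smul_eq_mul]
    apply mul_le_mul_of_nonneg_left _ (Nat.cast_nonneg ℓ)
    apply hM.mono _ _ (bdd_divSeq (bdd_cont h (fun n => T^[ℓ * n] a)) ℓ)
      (bdd_cont h (fun n => T^[n] a))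
    intro n
    by_cases hd : ℓ ∣ n
    · simp only [hd, if_true, Nat.mul_div_cancel' hd]; exact le_rfl
    · simp only [hd, if_false]; exact h0 _
  · have : IsFiniteMeasure (Measure.map (T^[ℓ]) ν) := inferInstance
    apply measure_eq_of_int
    intro h
    rw [integral_map hcont.measurable.aemeasurable h.continuous.measurable.aestronglyMeasurable]
    have e1 := hν (h.comp ⟨T^[ℓ], hcont⟩)
    simp only [ContinuousMap.comp_apply, ContinuousMap.coe_mk] at e1
    rw [e1, hν, ← hM'.shift (fun n => h (T^[ℓ * n] a)) (bdd_cont h _)]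
    congr 1
    ext n
    rw [← Function.iterate_add_apply, mul_add, mul_one, add_comm ℓ]

lemma map_withDensity_comp {Y : Type*} [MeasurableSpace Y] {ρ : Measure Y} {e e' : Y → Y}
    (he : MeasurePreserving e ρ ρ) (he' : Measurable e') (hinv : ∀ y, e' (e y) = y)
    {k : Y → ENNReal} (hk : Measurable k) :
    Measure.map e' (ρ.withDensity k) = ρ.withDensity (k ∘ e) := by
  ext A hA
  rw [Measure.map_apply he' hA, withDensity_apply _ (he' hA), withDensity_apply _ hA,
    ← he.setLIntegral_comp_preimage (he' hA) hk, ← Set.preimage_comp]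
  have : e' ∘ e = id := funext hinv
  rw [this]; rfl

/-- Properties of the density `K`. -/
lemma exists_K {X : Type*} [MetricSpace X] [CompactSpace X] [MeasurableSpace X]
    [BorelSpace X] (T : X ≃ₜ X) {μ ν : Measure X} [IsProbabilityMeasure μ] [IsProbabilityMeasure ν]
    (hT : MeasurePreserving T μ μ) {ℓ m : ℕ}
    (hac : ν ≪ μ) (hS : MeasurePreserving (T^[ℓ]) ν ν)
    {κ : Measure (X × X)} [IsFiniteMeasure κ] (hκ : κ ≤ μ.prod ν) {c : ℝ} (hc0 : 0 ≤ c)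
    (hsnd : Measure.map Prod.snd κ = ENNReal.ofReal c • ν)
    (hinv : Measure.map (Prod.map id (T.symm^[ℓ])) κ = Measure.map (Prod.map (T.symm^[m]) id) κ) :
    ∃ K : X × X → ℝ, Measurable K ∧ (∀ z, 0 ≤ K z) ∧ (∀ z, K z ≤ 1) ∧
      (∀ᵐ y ∂ν, ∫ x, K (x, y) ∂μ = c) ∧
      (∀ᵐ z ∂(μ.prod ν), K (z.1, T^[ℓ] z.2) = K (T^[m] z.1, z.2)) ∧
      ∀ A, MeasurableSet A → κ (A ×ˢ A) = 0 → ∀ᵐ y ∂ν, y ∈ A → ∫ x in A, K (x, y) ∂ν = 0 := by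
  let k := κ.rnDeriv (μ.prod ν)
  have hkm : Measurable k := Measure.measurable_rnDeriv _ _
  have hk1 : ∀ᵐ z ∂(μ.prod ν), k z ≤ 1 := Measure.rnDeriv_le_one_of_le hκ
  have hLD : κ.HaveLebesgueDecomposition (μ.prod ν) :=
    Measure.haveLebesgueDecomposition_of_finiteMeasure
  have hkκ : (μ.prod ν).withDensity k = κ :=
    Measure.withDensity_rnDeriv_eq _ _ (Measure.absolutelyContinuous_of_le hκ)
  have hswap : ∀ {P : X × X → Prop}, (∀ᵐ z ∂(μ.prod ν), P z) → ∀ᵐ y ∂ν, ∀ᵐ x ∂μ, P (x, y) := by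
    intro P h
    have h2 := (Measure.measurePreserving_swap (μ := ν) (ν := μ)).quasiMeasurePreserving.ae h
    exact Measure.ae_ae_of_ae_prod h2
  have hKk : ∀ᵐ z ∂(μ.prod ν), ENNReal.ofReal (min (k z).toReal 1) = k z := by
    filter_upwards [hk1] with z hz
    have hne : k z ≠ ⊤ := ne_top_of_le_ne_top ENNReal.one_ne_top hz
    have : (k z).toReal ≤ 1 := ENNReal.toReal_le_of_le_ofReal zero_le_one (by simpa using hz)
    rw [min_eq_left this, ENNReal.ofReal_toReal hne]
  have hKm : Measurable fun z => min (k z).toReal 1 := hkm.ennreal_toReal.min measurable_const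
  have hK0 : ∀ z, 0 ≤ min (k z).toReal 1 := fun z => le_min ENNReal.toReal_nonneg zero_le_one
  refine ⟨fun z => min (k z).toReal 1, hKm, hK0, fun z => min_le_right _ _, ?_, ?_, ?_⟩
  · have h1 : ν.withDensity (fun y => ∫⁻ x, k (x, y) ∂μ) = ν.withDensity (fun _ => ENNReal.ofReal c) := by
      rw [withDensity_const, ← hsnd, ← hkκ]
      ext A hA
      rw [Measure.map_apply measurable_snd hA, withDensity_apply _ hA,
        withDensity_apply _ (measurable_snd hA)]
      have hpre : (Prod.snd ⁻¹' A : Set (X × X)) = Set.univ ×ˢ A := by ext z; simp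
      rw [hpre, ← Measure.prod_restrict, Measure.restrict_univ, lintegral_prod_symm' _ hkm]
    have h2 := (withDensity_eq_iff_of_sigmaFinite
      (hkm.lintegral_prod_left').aemeasurable aemeasurable_const).mp h1
    filter_upwards [h2, hswap hKk] with y hy hy2
    rw [integral_eq_lintegral_of_nonneg_ae (Eventually.of_forall fun x => hK0 _)
      (hKm.comp (by fun_prop)).aestronglyMeasurable, lintegral_congr_ae hy2]
    rw [hy, ENNReal.toReal_ofReal hc0]
  · have hmS : Measurable (T.symm^[ℓ]) := (T.symm.continuous.iterate ℓ).measurable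
    have hmM : Measurable (T.symm^[m]) := (T.symm.continuous.iterate m).measurable
    have hp1 : MeasurePreserving (Prod.map id (T^[ℓ])) (μ.prod ν) (μ.prod ν) :=
      (MeasurePreserving.id μ).prod hS
    have hp2 : MeasurePreserving (Prod.map (T^[m]) id) (μ.prod ν) (μ.prod ν) :=
      (hT.iterate m).prod (MeasurePreserving.id ν)
    have hli : ∀ n x, T.symm^[n] (T^[n] x) = x := fun n =>
      Function.LeftInverse.iterate (fun x => T.symm_apply_apply x) n
    have hi1 : ∀ z : X × X, Prod.map id (T.symm^[ℓ]) (Prod.map id (T^[ℓ]) z) = z :=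
      fun z => Prod.ext rfl (hli _ _)
    have hi2 : ∀ z : X × X, Prod.map (T.symm^[m]) id (Prod.map (T^[m]) id z) = z :=
      fun z => Prod.ext (hli _ _) rfl
    rw [← hkκ, map_withDensity_comp hp1 (measurable_id.prodMap hmS) hi1 hkm,
      map_withDensity_comp hp2 (hmM.prodMap measurable_id) hi2 hkm] at hinv
    have h2 := (withDensity_eq_iff_of_sigmaFinite (hkm.comp hp1.measurable).aemeasurable
      (hkm.comp hp2.measurable).aemeasurable).mp hinv
    filter_upwards [h2] with z hz
    simp only [Function.comp, Prod.map, id] at hz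
    rw [hz]
  · intro A hA hz
    rw [← hkκ, withDensity_apply _ (hA.prod hA), lintegral_eq_zero_iff hkm] at hz
    have hz2 := (ae_restrict_iff' (hA.prod hA)).mp hz
    filter_upwards [hswap hz2] with y hy hyA
    have hy3 := hac.ae_le hy
    rw [← integral_zero X ℝ (μ := ν.restrict A)]
    apply integral_congr_ae
    rw [EventuallyEq, ae_restrict_iff' hA]
    filter_upwards [hy3] with x hx hxA
    have := hx ⟨hxA, hyA⟩
    simp only [Pi.zero_apply] at this
    simp [this]

lemma exists_lam {X : Type*} [MetricSpace X] [CompactSpace X] [MeasurableSpace X]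
    [BorelSpace X] (T : X ≃ₜ X) {μ ν : Measure X} [IsProbabilityMeasure μ] [IsProbabilityMeasure ν]
    (hT : MeasurePreserving T μ μ) (a : X) {M : (ℕ → ℝ) → ℝ} (hM : IsShiftMean M) {ℓ m : ℕ}
    (hν : ∀ f : C(X, ℝ), ∫ x, f x ∂ν = M (fun n => f (T^[ℓ * n] a)))
    (f : C(X, ℝ)) (f0 : ∀ x, 0 ≤ f x) (f1 : ∀ x, f x ≤ 1) :
    ∃ κ : Measure (X × X), IsFiniteMeasure κ ∧
      (∀ h : C(X × X, ℝ), ∫ z, h z ∂κ =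
        M (fun n => ∫ x, h (x, T^[ℓ * n] a) * f (T^[m * n] x) ∂μ)) ∧
      κ ≤ μ.prod ν ∧ Measure.map Prod.snd κ = ENNReal.ofReal (∫ x, f x ∂μ) • ν ∧
      Measure.map (Prod.map id (T.symm^[ℓ])) κ = Measure.map (Prod.map (T.symm^[m]) id) κ := by
  have hsc : SecondCountableTopology X := inferInstance
  have hTc : ∀ j, Continuous (T^[j]) := fun j => T.continuous.iterate j
  have hcx : ∀ (h : C(X × X, ℝ)) y j, Continuous fun x => h (x, y) * f (T^[j] x) := fun h y j =>
    (h.continuous.comp (by fun_prop)).mul (f.continuous.comp (hTc j))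
  have hbx : ∀ (h : C(X × X, ℝ)) y j x, |h (x, y) * f (T^[j] x)| ≤ ‖h‖ := fun h y j x => by
    rw [abs_mul, abs_of_nonneg (f0 _)]
    have := h.norm_coe_le_norm (x, y)
    rw [Real.norm_eq_abs] at this
    have h2 := mul_le_mul_of_nonneg_left (f1 (T^[j] x)) (abs_nonneg (h (x, y)))
    linarith
  have hix : ∀ (h : C(X × X, ℝ)) y j, Integrable (fun x => h (x, y) * f (T^[j] x)) μ :=
    fun h y j => integrable_of_meas_bdd (hcx h y j).measurable (hbx h y j)
  have hIb : ∀ (h : C(X × X, ℝ)) y j, |∫ x, h (x, y) * f (T^[j] x) ∂μ| ≤ ‖h‖ := fun h y j => by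
    have := norm_integral_le_of_norm_le_const (μ := μ) (C := ‖h‖)
      (f := fun x => h (x, y) * f (T^[j] x)) (Eventually.of_forall (hbx h y j))
    simpa using this
  have hbdd : ∀ (h : C(X × X, ℝ)),
      BddSeq (fun n => ∫ x, h (x, T^[ℓ * n] a) * f (T^[m * n] x) ∂μ) := fun h =>
    ⟨‖h‖, fun n => hIb _ _ _⟩
  obtain ⟨κ, hfin, hκ⟩ := exists_riesz (Y := X × X)
    (fun h => M (fun n => ∫ x, h (x, T^[ℓ * n] a) * f (T^[m * n] x) ∂μ))
    (fun h g => by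
      rw [← hM.add _ _ (hbdd h) (hbdd g)]
      congr 1; ext n
      rw [← integral_add (hix _ _ _) (hix _ _ _)]
      simp only [ContinuousMap.add_apply, add_mul])
    (fun c h => by
      rw [← hM.smul _ _ (hbdd h)]
      congr 1; ext n
      rw [← integral_const_mul]
      simp only [ContinuousMap.smul_apply, smul_eq_mul, mul_assoc])
    (fun h h0 => by
      have := hM.mono (fun _ => 0) _ (bddSeq_const 0) (hbdd h)
        (fun n => integral_nonneg fun x => mul_nonneg (h0 _) (f0 _))
      rwa [hM.const] at this)
  refine ⟨κ, hfin, hκ, ?_, ?_, ?_⟩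
  · apply measure_le_of_int
    intro h h0
    have hcy : Continuous fun y => ∫ x, h (x, y) ∂μ := by
      apply continuous_of_dominated (bound := fun _ => ‖h‖)
      · intro y
        exact (h.continuous.comp (by fun_prop : Continuous fun x : X => (x, y))).measurable.aestronglyMeasurable
      · exact fun y => Eventually.of_forall fun x => h.norm_coe_le_norm _
      · exact integrable_const _
      · exact Eventually.of_forall fun x => h.continuous.comp (by fun_prop)
    rw [hκ, integral_prod_symm _ (cont_integrable _ h)]
    have e := hν ⟨_, hcy⟩
    simp only [ContinuousMap.coe_mk] at e
    rw [e]
    apply hM.mono _ _ (hbdd h) (bdd_cont ⟨_, hcy⟩ _)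
    intro n
    have hi : Integrable (fun x => h (x, T^[ℓ * n] a)) μ :=
      cont_integrable μ ⟨fun x => h (x, T^[ℓ * n] a), h.continuous.comp (by fun_prop)⟩
    refine integral_mono (hix _ _ _) hi fun x => ?_
    exact mul_le_of_le_one_right (h0 _) (f1 _)
  · have hsf : IsFiniteMeasure (ENNReal.ofReal (∫ x, f x ∂μ) • ν) := ⟨by simp⟩
    apply measure_eq_of_int
    intro h
    rw [integral_map measurable_snd.aemeasurable h.continuous.measurable.aestronglyMeasurable]
    have e := hκ ⟨fun z => h z.2, h.continuous.comp continuous_snd⟩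
    simp only [ContinuousMap.coe_mk] at e
    rw [e, integral_smul_measure, hν, ENNReal.toReal_ofReal (integral_nonneg f0), smul_eq_mul,
      ← hM.smul _ _ (bdd_cont h _)]
    congr 1; ext n
    rw [integral_const_mul, mul_comm]
    congr 1
    have hp := hT.iterate (m * n)
    have h5 := integral_map (μ := μ) (φ := T^[m * n]) hp.measurable.aemeasurable
        (f := f) f.continuous.measurable.aestronglyMeasurable
    rw [hp.map_eq] at h5
    exact h5.symm
  · have hTs : ∀ j, Continuous (T.symm^[j]) := fun j => T.symm.continuous.iterate j
    have c1 : Continuous (Prod.map id (T.symm^[ℓ]) : X × X → X × X) := continuous_id.prodMap (hTs _)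
    have c2 : Continuous (Prod.map (T.symm^[m]) id : X × X → X × X) := (hTs _).prodMap continuous_id
    have hli : ∀ n x, T.symm^[n] (T^[n] x) = x := fun n =>
      Function.LeftInverse.iterate (fun x => T.symm_apply_apply x) n
    apply measure_eq_of_int
    intro h
    rw [integral_map c1.measurable.aemeasurable h.continuous.measurable.aestronglyMeasurable,
      integral_map c2.measurable.aemeasurable h.continuous.measurable.aestronglyMeasurable]
    have e1 := hκ (h.comp ⟨_, c1⟩)
    have e2 := hκ (h.comp ⟨_, c2⟩)
    have e3 := hM.shift _ (hbdd (h.comp ⟨_, c1⟩))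
    simp only [ContinuousMap.comp_apply, ContinuousMap.coe_mk, Prod.map, id] at e1 e2 e3
    simp only [Prod.map, id]
    rw [e1, e2, ← e3]
    congr 1; ext n
    have hp := hT.iterate m
    have h5 := integral_map (μ := μ) (φ := T^[m]) hp.measurable.aemeasurable
        (f := fun x => h (T.symm^[m] x, T^[ℓ * n] a) * f (T^[m * n] x))
        (((h.continuous.comp ((hTs m).prodMk continuous_const)).mul
          (f.continuous.comp (hTc _))).measurable.aestronglyMeasurable)
    rw [hp.map_eq] at h5
    rw [h5]
    congr 1; ext x
    rw [hli, show ℓ * (n + 1) = ℓ + ℓ * n by ring, Function.iterate_add_apply, hli,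
      mul_add, mul_one, Function.iterate_add_apply]

/-- The joining gives no mass to `D ×ˢ D`. -/
lemma lam_zero {X : Type*} [MetricSpace X] [CompactSpace X] [MeasurableSpace X]
    [BorelSpace X] {T : X → X} (hTc : Continuous T) {μ : Measure X} [IsProbabilityMeasure μ]
    (a : X) {M : (ℕ → ℝ) → ℝ} (hM : IsShiftMean M) {ℓ m : ℕ}
    (f : C(X, ℝ)) (f0 : ∀ x, 0 ≤ f x) (f1 : ∀ x, f x ≤ 1)
    {κ : Measure (X × X)} [IsFiniteMeasure κ]
    (hκ : ∀ h : C(X × X, ℝ), ∫ z, h z ∂κ =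
        M (fun n => ∫ x, h (x, T^[ℓ * n] a) * f (T^[m * n] x) ∂μ))
    {D V : Set X} (hD : MeasurableSet D) (hV : IsOpen V) (hDV : D ⊆ V) (k : ℕ)
    (hz : ∀ n, k ≤ n → T^[ℓ * n] a ∈ V → ∀ x ∈ D, f (T^[m * n] x) = 0) :
    κ (D ×ˢ D) = 0 := by
  have hsc : SecondCountableTopology X := inferInstance
  have hit : ∀ j, Continuous (T^[j]) := fun j => hTc.iterate j
  have key : ∀ ε : ENNReal, 0 < ε → ε ≠ ⊤ → κ (D ×ˢ D) ≤ ε := by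
    intro ε hε hεt
    obtain ⟨U, hUD, hU, -, hUε⟩ := hD.exists_isOpen_sdiff_lt (measure_ne_top μ D) hε.ne'
    have hm : MeasurableSet (U \ D) := hU.measurableSet.diff hD
    have hreal : μ.real (U \ D) ≤ ε.toReal := ENNReal.toReal_mono hεt hUε.le
    refine (measure_mono (Set.prod_mono hUD hDV)).trans ?_
    rw [← ENNReal.ofReal_toReal hεt]
    apply isOpen_measure_le κ (hU.prod hV)
    intro h h0 h1 hsupp
    rw [hκ, ← hM.const ε.toReal]
    have hcx : ∀ y j, Continuous fun x => h (x, y) * f (T^[j] x) := fun y j =>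
      (h.continuous.comp (by fun_prop)).mul (f.continuous.comp (hit j))
    have hnn : ∀ y j x, 0 ≤ h (x, y) * f (T^[j] x) := fun y j x => mul_nonneg (h0 _) (f0 _)
    have hle1 : ∀ y j x, h (x, y) * f (T^[j] x) ≤ 1 := fun y j x =>
      mul_le_one₀ (h1 _) (f0 _) (f1 _)
    have habs : ∀ y j x, |h (x, y) * f (T^[j] x)| ≤ 1 := fun y j x => by
      rw [abs_of_nonneg (hnn _ _ _)]; exact hle1 _ _ _
    have hix : ∀ y j, Integrable (fun x => h (x, y) * f (T^[j] x)) μ :=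
      fun y j => integrable_of_meas_bdd (hcx y j).measurable (habs y j)
    apply hM.mono_eventually _ (bddSeq_const _) k
    · intro n hn
      refine le_trans ?_ hreal
      rw [← integral_indicator_one hm]
      apply integral_mono (hix _ _) ((integrable_const (1 : ℝ)).indicator hm)
      intro x
      by_cases hy : T^[ℓ * n] a ∈ V
      · by_cases hx : x ∈ U \ D
        · simp only [Set.indicator_of_mem hx]
          exact hle1 _ _ _
        · simp only [Set.indicator_of_notMem hx]
          by_cases hxD : x ∈ D
          · rw [hz n hn hy x hxD, mul_zero]
          · have h00 : h (x, T^[ℓ * n] a) = 0 := hsupp _ (fun hc => hx ⟨hc.1, hxD⟩)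
            simp only [h00, zero_mul]; exact le_rfl
      · have h00 : h (x, T^[ℓ * n] a) = 0 := hsupp _ (fun hc => hy hc.2)
        simp only [h00, zero_mul]
        exact Set.indicator_nonneg (fun _ _ => zero_le_one) x
    · refine ⟨1, fun n => ?_⟩
      have := norm_integral_le_of_norm_le_const (μ := μ) (C := 1)
        (f := fun x => h (x, T^[ℓ * n] a) * f (T^[m * n] x)) (Eventually.of_forall (habs (T^[ℓ * n] a) (m * n)))
      simpa using this
  by_contra hne
  have hpos : 0 < κ (D ×ˢ D) := pos_iff_ne_zero.mpr hne
  have := key (κ (D ×ˢ D) / 2) (ENNReal.half_pos hne)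
    (ENNReal.div_ne_top (measure_ne_top _ _) (by simp))
  exact absurd (ENNReal.half_lt_self hne (measure_ne_top _ _)) (not_lt.mpr this)

/-- Finite measurable partition of a compact metric space into small pieces. -/
lemma exists_small_pieces {X : Type*} [MetricSpace X] [CompactSpace X] [MeasurableSpace X]
    [BorelSpace X] {δ : ℝ} (hδ : 0 < δ) :
    ∃ (n : ℕ) (p : Fin n → X) (P : Fin n → Set X), (∀ i, MeasurableSet (P i)) ∧
      Pairwise (Function.onFun Disjoint P) ∧ (⋃ i, P i) = Set.univ ∧
      ∀ i, P i ⊆ Metric.ball (p i) δ := by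
  obtain ⟨t, -, htf, ht⟩ := finite_cover_balls_of_compact (isCompact_univ (X := X)) hδ
  let s : Finset X := htf.toFinset
  let p : Fin s.card → X := fun i => (s.equivFin.symm i : X)
  refine ⟨s.card, p, disjointed fun i => Metric.ball (p i) δ, ?_, disjoint_disjointed _, ?_,
    fun i => disjointed_subset _ i⟩
  · intro i
    rw [disjointed_apply]
    apply Metric.isOpen_ball.measurableSet.diff
    rw [Finset.sup_set_eq_biUnion]
    exact Finset.measurableSet_biUnion _ fun j _ => Metric.isOpen_ball.measurableSet
  · rw [iUnion_disjointed, Set.eq_univ_iff_forall]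
    intro x
    obtain ⟨y, hy, hxy⟩ := Set.mem_iUnion₂.mp (ht (Set.mem_univ x))
    have hys : y ∈ s := htf.mem_toFinset.mpr hy
    refine Set.mem_iUnion.mpr ⟨s.equivFin ⟨y, hys⟩, ?_⟩
    simpa [p] using hxy

/-- Points not covered by the sets `D k` give progressions. -/
lemma exists_prog {X : Type*} [MetricSpace X] [CompactSpace X] {T : X → X} {ℓ m : ℕ} {a x : X}
    {f : X → ℝ} (h : ∀ k : ℕ, ∃ n, k ≤ n ∧ dist (T^[ℓ * n] a) x < ((k : ℝ) + 1)⁻¹ ∧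
      f (T^[m * n] x) ≠ 0) : ∃ x₂ ∈ tsupport f, ErdosProg T ℓ m a x x₂ := by
  obtain ⟨φ, hφ, hP⟩ := extraction_forall_of_frequently
    (P := fun k n => 0 < n ∧ dist (T^[ℓ * n] a) x < ((k : ℝ) + 1)⁻¹ ∧ f (T^[m * n] x) ≠ 0) (by
      intro k
      rw [frequently_atTop]
      intro N
      obtain ⟨n, hn, h1, h2⟩ := h (max N k + 1)
      refine ⟨n, by omega, by omega, h1.trans_le ?_, h2⟩
      have : (k : ℝ) ≤ ((max N k + 1 : ℕ) : ℝ) := by exact_mod_cast (by omega)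
      gcongr)
  obtain ⟨x₂, ψ, hψ, hlim⟩ := CompactSpace.tendsto_subseq (fun i => T^[m * φ i] x)
  refine ⟨x₂, ?_, fun i => φ (ψ i), hφ.comp hψ, fun i => (hP _).1, ?_⟩
  · apply mem_closure_of_tendsto hlim
    exact Eventually.of_forall fun i => (hP (ψ i)).2.2
  · apply Tendsto.prodMk_nhds _ hlim
    have h1 : Tendsto (fun i => T^[ℓ * φ i] a) atTop (𝓝 x) := by
      rw [tendsto_iff_dist_tendsto_zero]
      refine squeeze_zero (fun _ => dist_nonneg) (fun i => (hP i).2.1.le) ?_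
      simpa [one_div] using tendsto_one_div_add_atTop_nhds_zero_nat (𝕜 := ℝ)
    exact h1.comp hψ.tendsto_atTop

/-- **Dynamical theorem for unshifted unrestricted sumsets.** If `E, F` are open sets with
`(ℓ+m) μ(F) + ℓ μ(E) > 2ℓ + m - 1`, then there is an `(ℓ,m)`-Erdős progression
`(a, x₁, x₂)` with `(x₁, x₂) ∈ E × F`. -/
theorem dynamical_mB_add_lB_unrestricted_no_shift {X : Type*} [MetricSpace X]
    [CompactSpace X] [MeasurableSpace X] [BorelSpace X]
    (T : X ≃ₜ X) (μ : Measure X) [IsProbabilityMeasure μ]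
    (hT : Ergodic (⇑T) μ)
    (a : X) (Φ : ℕ → Finset ℕ) (hΦ : IsFolnerSeq Φ)
    (ha : GenericAlong (⇑T) μ a Φ)
    (ℓ m : ℕ) (hℓ : 0 < ℓ) (hm : 0 < m)
    (E F : Set X) (hE : IsOpen E) (hF : IsOpen F)
    (hineq : ((ℓ : ℝ) + m) * (μ F).toReal + ℓ * (μ E).toReal > 2 * ℓ + m - 1) :
    ∃ x₁ x₂ : X, ErdosProg (⇑T) ℓ m a x₁ x₂ ∧ x₁ ∈ E ∧ x₂ ∈ F := by
  by_contra hcon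
  push Not at hcon
  have hTc : ∀ j, Continuous (T^[j]) := fun j => T.continuous.iterate j
  -- choice of `ε`
  obtain ⟨ε, hε, hεlt⟩ : ∃ ε : ℝ, 0 < ε ∧ ((ℓ : ℝ) + m + 1) * ε <
      ((ℓ : ℝ) + m) * (μ F).toReal + ℓ * (μ E).toReal - (2 * ℓ + m - 1) := by
    set s := ((ℓ : ℝ) + m) * (μ F).toReal + ℓ * (μ E).toReal - (2 * ℓ + m - 1) with hs
    have hspos : 0 < s := by linarith
    refine ⟨s / ((ℓ : ℝ) + m + 2), by positivity, ?_⟩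
    have h2 : (0 : ℝ) < (ℓ : ℝ) + m + 2 := by positivity
    rw [← mul_div_assoc, div_lt_iff₀ h2]
    nlinarith
  -- the function `f`
  obtain ⟨F1, hF1F, hF1, hF1lt⟩ := hF.measurableSet.exists_isCompact_lt_add (μ := μ)
    (measure_ne_top _ _) (ε := ENNReal.ofReal ε) (by simpa using hε)
  obtain ⟨f, hfs, hf1, hf01⟩ := exists_tsupport_one_of_isOpen_isClosed hF
    isClosed_closure.isCompact hF1.isClosed hF1F
  have f0 : ∀ x, 0 ≤ f x := fun x => (hf01 x).1
  have f1 : ∀ x, f x ≤ 1 := fun x => (hf01 x).2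
  have hcF : (μ F).toReal - ε ≤ ∫ x, f x ∂μ := by
    have h1 : μ.real F1 ≤ ∫ x, f x ∂μ := by
      rw [← integral_indicator_one hF1.measurableSet]
      apply integral_mono ((integrable_const (1 : ℝ)).indicator hF1.measurableSet)
        (cont_integrable μ f)
      intro y
      by_cases hy : y ∈ F1
      · simp only [Set.indicator_of_mem hy]
        rw [hf1 hy]; exact le_rfl
      · simp only [Set.indicator_of_notMem hy]
        exact f0 y
    have h2 : (μ F).toReal ≤ μ.real F1 + ε := by
      have := ENNReal.toReal_mono (by finiteness) hF1lt.le
      rwa [ENNReal.toReal_add (measure_ne_top _ _) ENNReal.ofReal_ne_top,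
        ENNReal.toReal_ofReal hε.le] at this
    linarith
  have hc1 : ∫ x, f x ∂μ ≤ 1 := by
    have := integral_mono (cont_integrable μ f) (integrable_const (1 : ℝ)) f1
    simpa using this
  -- the measures
  obtain ⟨M, hM, hMlim⟩ := exists_mean Φ hΦ
  have hgen : ∀ f : C(X, ℝ), M (fun n => f (T^[n] a)) = ∫ x, f x ∂μ := fun f =>
    hMlim _ _ (ha f)
  obtain ⟨ν, hνp, hν, hνle, hS⟩ := exists_nu T μ a hM hgen hℓ
  have hM' := divMean_isShiftMean hM hℓ
  obtain ⟨κ, hκfin, hκ, hκle, hκsnd, hκinv⟩ :=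
    exists_lam T (m := m) hT.toMeasurePreserving a hM' hν f f0 f1
  have hac : ν ≪ μ := (Measure.absolutelyContinuous_of_le hνle).trans
    Measure.smul_absolutelyContinuous
  obtain ⟨K, hKm, hK0, hK1, hKb, hKc, hKd⟩ := exists_K T hT.toMeasurePreserving hac hS hκle
    (integral_nonneg f0) hκsnd hκinv
  -- the sets `D k`
  let D : ℕ → Set X := fun k => E ∩ ⋂ n : ℕ, {x | k ≤ n →
    dist (T^[ℓ * n] a) x < ((k : ℝ) + 1)⁻¹ → f (T^[m * n] x) = 0}
  have hDm : ∀ k, MeasurableSet (D k) := by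
    intro k
    refine hE.measurableSet.inter (MeasurableSet.iInter fun n => ?_)
    have h1 : IsOpen {x | dist (T^[ℓ * n] a) x < ((k : ℝ) + 1)⁻¹} :=
      isOpen_lt (continuous_const.dist continuous_id) continuous_const
    have h2 : IsClosed {x | f (T^[m * n] x) = 0} :=
      isClosed_eq (f.continuous.comp (hTc _)) continuous_const
    by_cases hk : k ≤ n
    · have : {x | k ≤ n → dist (T^[ℓ * n] a) x < ((k : ℝ) + 1)⁻¹ → f (T^[m * n] x) = 0} =
          {x | dist (T^[ℓ * n] a) x < ((k : ℝ) + 1)⁻¹}ᶜ ∪ {x | f (T^[m * n] x) = 0} := by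
        ext x
        constructor
        · intro hx
          by_cases hd : dist (T^[ℓ * n] a) x < ((k : ℝ) + 1)⁻¹
          · exact Or.inr (hx hk hd)
          · exact Or.inl hd
        · rintro (hx | hx) _ hd
          · exact absurd hd hx
          · exact hx
      rw [this]
      exact h1.measurableSet.compl.union h2.measurableSet
    · have : {x | k ≤ n → dist (T^[ℓ * n] a) x < ((k : ℝ) + 1)⁻¹ → f (T^[m * n] x) = 0} =
          Set.univ := by
        ext x
        exact ⟨fun _ => trivial, fun _ h => absurd h hk⟩
      rw [this]
      exact MeasurableSet.univ
  have hDmono : Monotone D := by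
    intro k l hkl x hx
    refine ⟨hx.1, Set.mem_iInter.mpr fun n hn hd => ?_⟩
    refine Set.mem_iInter.mp hx.2 n (hkl.trans hn) (hd.trans_le ?_)
    have : (k : ℝ) ≤ l := by exact_mod_cast hkl
    gcongr
  have hDU : ⋃ k, D k = E := by
    apply Set.Subset.antisymm (Set.iUnion_subset fun k => Set.inter_subset_left)
    intro x hx
    by_contra hnot
    have hall : ∀ k : ℕ, ∃ n, k ≤ n ∧ dist (T^[ℓ * n] a) x < ((k : ℝ) + 1)⁻¹ ∧
        f (T^[m * n] x) ≠ 0 := by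
      intro k
      by_contra hk
      push Not at hk
      exact hnot (Set.mem_iUnion.mpr ⟨k, hx, Set.mem_iInter.mpr fun n hn hd => hk n hn hd⟩)
    obtain ⟨x₂, hx₂, hprog⟩ := exists_prog hall
    exact hcon x x₂ hprog hx (hfs hx₂)
  obtain ⟨k, hk⟩ : ∃ k, ν.real E - ε < ν.real (D k) := by
    have ht := tendsto_measure_iUnion_atTop (μ := ν) hDmono
    rw [hDU] at ht
    have ht2 := (ENNReal.tendsto_toReal (measure_ne_top ν E)).comp ht
    exact (ht2.eventually (lt_mem_nhds (sub_lt_self _ hε))).exists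
  have hδ : (0 : ℝ) < ((k : ℝ) + 1)⁻¹ / 2 := by positivity
  obtain ⟨n, p, P, hPm, hPd, hPU, hPb⟩ := exists_small_pieces (X := X) hδ
  have hcore := core hT (m := m) hℓ hνle hS hKm hK0 hK1 hc1 hKb hKc (D := fun i => D k ∩ P i)
    (fun i => (hDm k).inter (hPm i))
    (fun i j hij => (hPd hij).mono Set.inter_subset_right Set.inter_subset_right) (by
      intro i
      apply hKd _ ((hDm k).inter (hPm i))
      refine lam_zero T.continuous a hM' f f0 f1 hκ ((hDm k).inter (hPm i))
        (V := Metric.ball (p i) (((k : ℝ) + 1)⁻¹ / 2)) Metric.isOpen_ball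
        (fun x hx => hPb i hx.2) k ?_
      intro n hn hV x hx
      refine Set.mem_iInter.mp hx.1.2 n hn ?_
      have h1 := Metric.mem_ball.mp hV
      have h2 := Metric.mem_ball'.mp (hPb i hx.2)
      have h3 := dist_triangle (T^[ℓ * n] a) (p i) x
      linarith)
  rw [← Set.inter_iUnion, hPU, Set.inter_univ] at hcore
  -- final computation
  have hEν : 1 - ℓ * (1 - (μ E).toReal) ≤ ν.real E := by
    have h1 : ν Eᶜ ≤ (ℓ : ENNReal) * μ Eᶜ := by
      have := hνle Eᶜ
      simpa using this
    have h2 : ν.real Eᶜ ≤ ℓ * μ.real Eᶜ := by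
      have := ENNReal.toReal_mono (by finiteness) h1
      simpa [Measure.real] using this
    rw [probReal_compl_eq_one_sub hE.measurableSet,
      probReal_compl_eq_one_sub hE.measurableSet] at h2
    change 1 - ℓ * (1 - μ.real E) ≤ _
    linarith
  have hpos : (0 : ℝ) ≤ (ℓ : ℝ) + m := by positivity
  have h5 := mul_le_mul_of_nonneg_left hcF hpos
  nlinarith
end

section
/- Let A ⊆ ℕ, let ℓ, m be positive integers with k = m/ℓ, and let q = ⌈k⌉. Then there exist a Borel probability measure μ on Σ × Σ that is invariant and ergodic for S^{q+1} × S, an open set E ⊆ Σ, points a, a' ∈ Σ, and a Følner sequence Φ in ℕ, such that (a', a) is (S^{q+1} × S)-generic for μ along Φ, and (ℓ+m)·μ(Σ × E) + ℓ·Σ_{j=0}^{q} μ(S^{−j}E × Σ) ≥ (ℓ+m)·((k+1)·d̄(A) − k) + ℓ·(k+1)·d̄(A) + ℓ(q − k). Moreover A = {n ∈ ℕ : S^n a ∈ E} and, for each j = 0, 1, …, ℓ+m−1, {n ∈ ℕ : n(ℓ+m) + j ∈ A} = {n ∈ ℕ : S^{(q+1)ℓn + j} a' ∈ E}. -/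
open Filter MeasureTheory Topology

open scoped Classical in
/-- Upper Banach density: `limsup` over window length `N` of the maximal count of
elements of `A` in a window of length `N`, divided by `N`. -/
noncomputable def upperBanachDensity (A : Set ℕ) : ℝ :=
  Filter.limsup
    (fun N : ℕ => ⨆ M : ℕ, (((Finset.Ico M (M + N)).filter (· ∈ A)).card : ℝ) / N)
    Filter.atTop

open scoped Classical in
/-- Natural upper density of a set of naturals. -/
noncomputable def upperDensity (A : Set ℕ) : ℝ :=
  Filter.limsup (fun N : ℕ => (((Finset.Icc 1 N).filter (· ∈ A)).card : ℝ) / N)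
    Filter.atTop

open scoped Classical in
/-- Natural lower density of a set of naturals. -/
noncomputable def lowerDensity (A : Set ℕ) : ℝ :=
  Filter.liminf (fun N : ℕ => (((Finset.Icc 1 N).filter (· ∈ A)).card : ℝ) / N)
    Filter.atTop

/-- The space `Σ = {0,1}^ℤ` (with the product topology). -/
abbrev BinSeq := ℤ → Bool

/-- The shift transformation `S` on `{0,1}^ℤ`, `S(x)(n) = x(n+1)`. -/
def shiftS : BinSeq → BinSeq := fun x n => x (n + 1)


set_option linter.unusedSectionVars false

section
variable {X : Type*} [TopologicalSpace X] [CompactSpace X]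

/-- invariant states supported on the orbit closure of `x0` -/
def IK (T : C(X, X)) (x0 : X) : Set (C(X, ℝ) → ℝ) :=
  {L | (∀ f g, L (f + g) = L f + L g) ∧ (∀ (c : ℝ) f, L (c • f) = c * L f) ∧ L 1 = 1 ∧
    (∀ g : C(X, ℝ), (∀ n : ℕ, 0 ≤ g (T^[n] x0)) → 0 ≤ L g) ∧ (∀ g : C(X, ℝ), L (g.comp T) = L g)}

lemma IK_closed (T : C(X, X)) (x0 : X) : IsClosed (IK T x0) := by
  unfold IK
  simp only [Set.ofPred_and, Set.ofPred_forall]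
  refine IsClosed.inter ?_ (IsClosed.inter ?_ (IsClosed.inter ?_ (IsClosed.inter ?_ ?_)))
  · exact isClosed_iInter fun f => isClosed_iInter fun g =>
      isClosed_eq (by fun_prop) (by fun_prop)
  · exact isClosed_iInter fun f => isClosed_iInter fun g =>
      isClosed_eq (by fun_prop) (by fun_prop)
  · exact isClosed_eq (by fun_prop) (by fun_prop)
  · exact isClosed_iInter fun f => isClosed_iInter fun g =>
      isClosed_le (by fun_prop) (by fun_prop)
  · exact isClosed_iInter fun f => isClosed_eq (by fun_prop) (by fun_prop)

lemma IK_bound {T : C(X, X)} {x0 : X} {L : C(X, ℝ) → ℝ} (hL : L ∈ IK T x0) (g : C(X, ℝ)) :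
    L g ∈ Set.Icc (-‖g‖) ‖g‖ := by
  obtain ⟨hadd, hsm, h1, hpos, -⟩ := hL
  have a := hpos (‖g‖ • (1 : C(X, ℝ)) + g) (fun n => by
    have := g.neg_norm_le_apply (T^[n] x0)
    simp; linarith)
  have b := hpos (‖g‖ • (1 : C(X, ℝ)) + (-1 : ℝ) • g) (fun n => by
    have := g.apply_le_norm (T^[n] x0)
    simp; linarith)
  rw [hadd, hsm, h1] at a b
  rw [hsm] at b
  constructor <;> linarith

lemma IK_compact (T : C(X, X)) (x0 : X) : IsCompact (IK T x0) :=
  (isCompact_univ_pi (fun g : C(X, ℝ) => isCompact_Icc (a := -‖g‖) (b := ‖g‖))).of_isClosed_subset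
    (IK_closed T x0) (fun _ hL g _ => IK_bound hL g)

/-- averages along the orbit -/
noncomputable def avg (T : C(X, X)) (x0 : X) (n : ℕ) (g : C(X, ℝ)) : ℝ :=
  (∑ i ∈ Finset.range n, g (T^[i] x0)) / n

lemma exists_state (T : C(X, X)) (x0 : X) (f : C(X, ℝ)) (c : ℝ) (N : ℕ → ℕ)
    (hN : Tendsto N atTop atTop)
    (h : ∀ ε > 0, ∀ᶠ i in atTop, c - ε ≤ avg T x0 (N i) f) :
    ∃ L ∈ IK T x0, c ≤ L f := by
  have hb : ∀ n (g : C(X, ℝ)), avg T x0 n g ∈ Set.Icc (-‖g‖) ‖g‖ := by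
    intro n g
    rcases Nat.eq_zero_or_pos n with rfl | hn
    · simp [avg]
    have hn' : (0 : ℝ) < n := by exact_mod_cast hn
    constructor
    · rw [avg, le_div_iff₀ hn']
      calc -‖g‖ * n = ∑ i ∈ Finset.range n, (-‖g‖) := by simp; ring
        _ ≤ _ := Finset.sum_le_sum fun i _ => g.neg_norm_le_apply _
    · rw [avg, div_le_iff₀ hn']
      calc _ ≤ ∑ i ∈ Finset.range n, (‖g‖) := Finset.sum_le_sum fun i _ => g.apply_le_norm _
        _ = _ := by simp; ring
  obtain ⟨L, -, hL⟩ := (isCompact_univ_pi (fun g : C(X, ℝ) =>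
    isCompact_Icc (a := -‖g‖) (b := ‖g‖))).ultrafilter_le_nhds
    ((Filter.hyperfilter ℕ).map (fun i => avg T x0 (N i))) (by
      rw [Ultrafilter.coe_map, le_principal_iff]
      exact Filter.mem_map.2 (Filter.Eventually.of_forall (fun i g _ => hb _ _)))
  have hL : Tendsto (fun i => avg T x0 (N i)) (Filter.hyperfilter ℕ) (𝓝 L) := hL
  have hev : ∀ g, Tendsto (fun i => avg T x0 (N i) g) (Filter.hyperfilter ℕ) (𝓝 (L g)) :=
    fun g => (tendsto_pi_nhds.1 hL) g
  have hle : (Filter.hyperfilter ℕ : Filter ℕ) ≤ atTop := Nat.hyperfilter_le_atTop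
  refine ⟨L, ⟨?_, ?_, ?_, ?_, ?_⟩, ?_⟩
  · intro f g
    refine tendsto_nhds_unique (hev _) (((hev f).add (hev g)).congr fun i => ?_)
    simp [avg, Finset.sum_add_distrib, add_div]
  · intro a g
    refine tendsto_nhds_unique (hev _) (((hev g).const_mul a).congr fun i => ?_)
    simp [avg, ← Finset.mul_sum, mul_div_assoc]
  · refine tendsto_nhds_unique (hev _) (tendsto_const_nhds.congr' ?_)
    filter_upwards [hle ((hN.eventually (eventually_gt_atTop 0)))] with i hi
    have : (N i : ℝ) ≠ 0 := by have : 0 < N i := hi; positivity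
    simp [avg, this]
  · intro g hg
    refine ge_of_tendsto (hev g) (Eventually.of_forall fun i => ?_)
    exact div_nonneg (Finset.sum_nonneg fun _ _ => hg _) (by positivity)
  · intro g
    have h0 : Tendsto (fun i => avg T x0 (N i) (g.comp T) - avg T x0 (N i) g)
        (Filter.hyperfilter ℕ) (𝓝 0) := by
      have h2 : Tendsto (fun i => (2 * ‖g‖) / (N i : ℝ)) (Filter.hyperfilter ℕ) (𝓝 0) :=
        ((tendsto_const_nhds.div_atTop tendsto_natCast_atTop_atTop).comp hN).mono_left hle
      refine squeeze_zero_norm (fun i => ?_) h2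
      have : avg T x0 (N i) (g.comp T) - avg T x0 (N i) g
          = (g (T^[N i] x0) - g x0) / N i := by
        rw [avg, avg, ← sub_div, ← Finset.sum_sub_distrib]
        congr 1
        have := Finset.sum_range_sub (fun j => g (T^[j] x0)) (N i)
        simp only [Function.iterate_zero, id] at this
        rw [← this]
        refine Finset.sum_congr rfl fun j _ => ?_
        rw [Function.iterate_succ_apply']; rfl
      rw [this, norm_div, Real.norm_natCast]
      gcongr
      calc _ ≤ ‖g (T^[N i] x0)‖ + ‖g x0‖ := norm_sub_le _ _
        _ ≤ _ := by linarith [g.norm_coe_le_norm (T^[N i] x0), g.norm_coe_le_norm x0]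
    have := tendsto_nhds_unique ((hev (g.comp T)).sub (hev g)) h0
    linarith
  · refine le_of_forall_pos_le_add fun ε hε => ?_
    have := ge_of_tendsto (hev f) (hle (h ε hε))
    linarith

lemma exists_extreme (T : C(X, X)) (x0 : X) (f : C(X, ℝ)) (c : ℝ)
    (h : ∃ L ∈ IK T x0, c ≤ L f) :
    ∃ L ∈ (IK T x0).extremePoints ℝ, c ≤ L f := by
  obtain ⟨L0, hL0, hc⟩ := h
  let l : StrongDual ℝ (C(X, ℝ) → ℝ) := ContinuousLinearMap.proj f
  have hexp : IsExposed ℝ (IK T x0) (l.toExposed (IK T x0)) :=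
    ContinuousLinearMap.toExposed.isExposed
  have hcpt := hexp.isCompact (IK_compact T x0)
  obtain ⟨L1, hL1, hmax⟩ := (IK_compact T x0).exists_isMaxOn ⟨L0, hL0⟩
    (f := fun L => l L) l.continuous.continuousOn
  obtain ⟨L, hL⟩ := hcpt.extremePoints_nonempty ⟨L1, hL1, fun y hy => hmax hy⟩
  exact ⟨L, hexp.isExtreme.extremePoints_subset_extremePoints hL, hc.trans (hL.1.2 L0 hL0)⟩

variable [TopologicalSpace.MetrizableSpace X] [MeasurableSpace X] [BorelSpace X]

lemma exists_measure {T : C(X, X)} {x0 : X} {L : C(X, ℝ) → ℝ} (hL : L ∈ IK T x0) :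
    ∃ μ : Measure X, IsProbabilityMeasure μ ∧ (∀ g : C(X, ℝ), ∫ x, g x ∂μ = L g) ∧
      MeasurePreserving T μ μ ∧ ∀ᵐ y ∂μ, y ∈ closure (Set.range fun n : ℕ => T^[n] x0) := by
  obtain ⟨hadd, hsm, h1, hpos, hinv⟩ := hL
  let Λ : CompactlySupportedContinuousMap X ℝ →ₚ[ℝ] ℝ :=
  { toFun g := L g.toContinuousMap
    map_add' g g' := hadd _ _
    map_smul' c g := hsm _ _
    monotone' g g' hgg' := by
      have := hpos (g'.toContinuousMap + (-1 : ℝ) • g.toContinuousMap) (fun n => by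
        have : g (T^[n] x0) ≤ g' (T^[n] x0) := hgg' _
        simpa using this)
      rw [hadd, hsm] at this
      show L g.toContinuousMap ≤ L g'.toContinuousMap
      linarith }
  have hint : ∀ g : C(X, ℝ), ∫ x, g x ∂(RealRMK.rieszMeasure Λ) = L g := fun g =>
    RealRMK.integral_rieszMeasure Λ (CompactlySupportedContinuousMap.continuousMapEquiv g)
  set μ := RealRMK.rieszMeasure Λ with hμ
  have hfin : IsFiniteMeasure μ := inferInstance
  have hprob : IsProbabilityMeasure μ := by
    have := hint 1
    rw [h1] at this
    simp at this
    constructor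
    rw [← ENNReal.toReal_eq_one_iff]
    exact this
  refine ⟨μ, hprob, hint, ?_, ?_⟩
  · refine ⟨T.continuous.measurable, ?_⟩
    have : IsProbabilityMeasure (μ.map T) := Measure.isProbabilityMeasure_map
      T.continuous.measurable.aemeasurable
    let _ := TopologicalSpace.metrizableSpaceMetric X
    refine ext_of_forall_integral_eq_of_IsFiniteMeasure fun f => ?_
    rw [integral_map T.continuous.measurable.aemeasurable
      f.continuous.measurable.aestronglyMeasurable]
    have a := hint f.toContinuousMap
    have b := hint (f.toContinuousMap.comp T)
    rw [hinv, ← a] at b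
    exact b
  · let _ := TopologicalSpace.metrizableSpaceMetric X
    set Y := closure (Set.range fun n : ℕ => T^[n] x0) with hY
    have hYne : Y.Nonempty := ⟨x0, subset_closure ⟨0, rfl⟩⟩
    let g : C(X, ℝ) := ⟨fun y => Metric.infDist y Y, Metric.continuous_infDist_pt Y⟩
    have hg0 : ∫ x, g x ∂μ = 0 := by
      have hz : ∀ n : ℕ, g (T^[n] x0) = 0 := fun n =>
        Metric.infDist_zero_of_mem (subset_closure ⟨n, rfl⟩)
      have a := hpos g (fun n => (hz n).ge)
      have b := hpos ((-1 : ℝ) • g) (fun n => by simp [hz n])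
      rw [hsm] at b
      rw [hint]; linarith
    have hi : Integrable g μ := g.continuous.integrable_of_hasCompactSupport
      (HasCompactSupport.of_compactSpace _)
    have := (integral_eq_zero_iff_of_nonneg (fun x => Metric.infDist_nonneg) hi).1 hg0
    filter_upwards [this] with y hy
    exact (isClosed_closure.mem_iff_infDist_zero hYne).2 hy

lemma mem_IK_of_measure {T : C(X, X)} {x0 : X} (μ : Measure X) [IsProbabilityMeasure μ]
    (hT : MeasurePreserving T μ μ)
    (hY : ∀ᵐ y ∂μ, y ∈ closure (Set.range fun n : ℕ => T^[n] x0)) :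
    (fun g : C(X, ℝ) => ∫ x, g x ∂μ) ∈ IK T x0 := by
  have hi : ∀ g : C(X, ℝ), Integrable g μ := fun g =>
    g.continuous.integrable_of_hasCompactSupport (HasCompactSupport.of_compactSpace _)
  refine ⟨fun f g => ?_, fun c f => ?_, ?_, fun g hg => ?_, fun g => ?_⟩
  · exact integral_add (hi f) (hi g)
  · exact integral_const_mul c f
  · simp
  · refine integral_nonneg_of_ae ?_
    filter_upwards [hY] with y hy
    have : closure (Set.range fun n : ℕ => T^[n] x0) ⊆ {y | 0 ≤ g y} :=
      closure_minimal (by rintro _ ⟨n, rfl⟩; exact hg n)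
        (isClosed_le continuous_const g.continuous)
    exact this hy
  · have := integral_map (μ := μ) T.continuous.measurable.aemeasurable
      (f := g) g.continuous.measurable.aestronglyMeasurable
    rw [hT.map_eq] at this
    exact this.symm

lemma ergodic_of_extreme {T : C(X, X)} {x0 : X} {L : C(X, ℝ) → ℝ}
    (hL : L ∈ (IK T x0).extremePoints ℝ) (μ : Measure X) [IsProbabilityMeasure μ]
    (hint : ∀ g : C(X, ℝ), ∫ x, g x ∂μ = L g)
    (hT : MeasurePreserving T μ μ)
    (hY : ∀ᵐ y ∂μ, y ∈ closure (Set.range fun n : ℕ => T^[n] x0)) : Ergodic T μ := by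
  apply Ergodic.of_mem_extremePoints
  rw [mem_extremePoints_iff_left]
  refine ⟨⟨hT, inferInstance⟩, ?_⟩
  rintro ν₁ ⟨h₁, p₁⟩ ν₂ ⟨h₂, p₂⟩ ⟨a, b, ha, hb, hab, heq⟩
  have hac₁ : ν₁ ≪ μ := by
    rw [← heq]
    exact (Measure.absolutelyContinuous_smul ha.ne').trans
      (Measure.AbsolutelyContinuous.rfl.add_right _)
  have hac₂ : ν₂ ≪ μ := by
    rw [← heq, add_comm]
    exact (Measure.absolutelyContinuous_smul hb.ne').trans
      (Measure.AbsolutelyContinuous.rfl.add_right _)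
  have m₁ := mem_IK_of_measure ν₁ h₁ (hac₁.ae_le hY)
  have m₂ := mem_IK_of_measure ν₂ h₂ (hac₂.ae_le hY)
  have hat : a ≠ ⊤ := fun h => by simp [h] at hab
  have hbt : b ≠ ⊤ := fun h => by simp [h] at hab
  have hi : ∀ (ν : Measure X) [IsFiniteMeasure ν] (g : C(X, ℝ)), Integrable g ν := fun ν _ g =>
    g.continuous.integrable_of_hasCompactSupport (HasCompactSupport.of_compactSpace _)
  have key := (mem_extremePoints_iff_left.1 hL).2 _ m₁ _ m₂
    ⟨a.toReal, b.toReal, ENNReal.toReal_pos ha.ne' hat, ENNReal.toReal_pos hb.ne' hbt, by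
      rw [← ENNReal.toReal_add hat hbt, hab]; rfl, by
      funext g
      rw [← hint g, ← heq, integral_add_measure ((hi ν₁ g).smul_measure hat)
        ((hi ν₂ g).smul_measure hbt), integral_smul_measure, integral_smul_measure]
      rfl⟩
  let _ := TopologicalSpace.metrizableSpaceMetric X
  refine ext_of_forall_integral_eq_of_IsFiniteMeasure fun f => ?_
  have := congrFun key f.toContinuousMap
  rw [← hint] at this
  exact this

lemma avg_continuous (T : C(X, X)) (n : ℕ) (g : C(X, ℝ)) :
    Continuous fun x => avg T x n g := by
  unfold avg
  refine Continuous.div_const (continuous_finsetSum _ fun i _ => ?_) _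
  exact g.continuous.comp (T.continuous.iterate i)

lemma mean_ergodic_s9 (T : C(X, X)) (μ : Measure X) [IsProbabilityMeasure μ] (he : Ergodic T μ)
    (g : C(X, ℝ)) :
    Tendsto (fun n => ∫ x, (avg T x n g - ∫ y, g y ∂μ) ^ 2 ∂μ) atTop (𝓝 0) := by
  have hT := he.toMeasurePreserving
  have hi : ∀ h : X → ℝ, Continuous h → Integrable h μ := fun h hh =>
    hh.integrable_of_hasCompactSupport (HasCompactSupport.of_compactSpace _)
  have hmem : MemLp g 2 μ := MemLp.of_bound g.continuous.aestronglyMeasurable ‖g‖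
    (Eventually.of_forall g.norm_coe_le_norm)
  let U := (Lp.compMeasurePreservingₗᵢ (E := ℝ) (p := 2) ℝ T hT)
  let V : Lp ℝ 2 μ →L[ℝ] Lp ℝ 2 μ := U.toContinuousLinearMap
  have hV : ‖V‖ ≤ 1 := U.norm_toContinuousLinearMap_le
  let G : Lp ℝ 2 μ := hmem.toLp g
  have hlim := V.tendsto_birkhoffAverage_orthogonalProjection hV G
  obtain ⟨⟨P, hP⟩, hlim⟩ : ∃ P : (V.eqLocus (1 : Lp ℝ 2 μ →L[ℝ] Lp ℝ 2 μ)),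
      Tendsto (birkhoffAverage ℝ V _root_.id · G) atTop (𝓝 (P : Lp ℝ 2 μ)) := ⟨_, hlim⟩
  have hVP : V P = P := hP
  obtain ⟨c, hc⟩ : ∃ c : ℝ, P =ᵐ[μ] fun _ => c := by
    refine he.ae_eq_const_of_ae_eq_comp_ae (Lp.aestronglyMeasurable P) ?_
    refine (Lp.coeFn_compMeasurePreserving P hT).symm.trans ?_
    have : Lp.compMeasurePreserving T hT P = P := hVP
    rw [this]
  have hiter : ∀ i : ℕ, (V^[i] G : Lp ℝ 2 μ) =ᵐ[μ] fun x => g (T^[i] x) := by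
    intro i
    have : V^[i] G = Lp.compMeasurePreserving T^[i] (hT.iterate i) G := by
      rw [← Lp.compMeasurePreserving_iterate]; rfl
    rw [this]
    refine (Lp.coeFn_compMeasurePreserving _ _).trans ?_
    exact (hT.iterate i).quasiMeasurePreserving.ae_eq_comp hmem.coeFn_toLp
  have havg : ∀ n : ℕ, (birkhoffAverage ℝ V _root_.id n G : Lp ℝ 2 μ) =ᵐ[μ]
      fun x => avg T x n g := by
    intro n
    unfold birkhoffAverage birkhoffSum
    have h1 : (∑ i ∈ Finset.range n, V^[i] G : Lp ℝ 2 μ) =ᵐ[μ]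
        fun x => ∑ i ∈ Finset.range n, g (T^[i] x) := by
      induction n with
      | zero => simpa using! Lp.coeFn_zero ℝ 2 μ
      | succ n ih =>
        rw [Finset.sum_range_succ]
        filter_upwards [Lp.coeFn_add (∑ i ∈ Finset.range n, V^[i] G) (V^[n] G), ih, hiter n]
          with x h1 h2 h3
        rw [h1, Pi.add_apply, h2, h3, Finset.sum_range_succ]
    filter_upwards [Lp.coeFn_smul (n : ℝ)⁻¹ (∑ i ∈ Finset.range n, V^[i] G), h1] with x h2 h3
    simp only [id]
    rw [h2, Pi.smul_apply, h3, avg, smul_eq_mul]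
    ring
  have hc0 : Tendsto (fun n => ∫ x, (avg T x n g - c) ^ 2 ∂μ) atTop (𝓝 0) := by
    have h1 : Tendsto (fun n => ‖birkhoffAverage ℝ V _root_.id n G - P‖ ^ 2) atTop (𝓝 0) := by
      have := (tendsto_iff_norm_sub_tendsto_zero.1 hlim).pow 2
      simpa using this
    refine h1.congr fun n => ?_
    rw [← real_inner_self_eq_norm_sq, L2.inner_def]
    refine integral_congr_ae ?_
    filter_upwards [Lp.coeFn_sub (birkhoffAverage ℝ V _root_.id n G) P, havg n, hc]
      with x h1 h2 h3
    rw [h1, Pi.sub_apply, h2, h3]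
    simp [sq]
  have hintavg : ∀ n : ℕ, 0 < n → ∫ x, avg T x n g ∂μ = ∫ x, g x ∂μ := by
    intro n hn
    have hn' : (n : ℝ) ≠ 0 := by positivity
    unfold avg
    rw [integral_div, integral_finsetSum]
    · have : ∀ i ∈ Finset.range n, ∫ x, g (T^[i] x) ∂μ = ∫ x, g x ∂μ := by
        intro i _
        have h := integral_map (μ := μ) (T.continuous.iterate i).measurable.aemeasurable
          (f := g) g.continuous.measurable.aestronglyMeasurable
        rw [(hT.iterate i).map_eq] at h
        exact h.symm
      rw [Finset.sum_congr rfl this]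
      simp; field_simp
    · intro i _
      exact hi _ (g.continuous.comp (T.continuous.iterate i))
  have hcg : c = ∫ x, g x ∂μ := by
    have hle : ((∫ x, g x ∂μ) - c) ^ 2 ≤ 0 := by
      refine ge_of_tendsto hc0 ?_
      filter_upwards [eventually_gt_atTop 0] with n hn
      set h : X → ℝ := fun x => avg T x n g - c with hh
      have hcont : Continuous h := (avg_continuous T n g).sub continuous_const
      have e1 : ∫ x, h x ∂μ = (∫ x, g x ∂μ) - c := by
        rw [hh, integral_sub (hi _ (avg_continuous T n g)) (integrable_const _), hintavg n hn]
        simp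
      set t := (∫ x, g x ∂μ) - c
      have e2 : 0 ≤ ∫ x, (h x - t) ^ 2 ∂μ := integral_nonneg fun x => sq_nonneg _
      have e3 : ∫ x, (h x - t) ^ 2 ∂μ = ∫ x, (h x ^ 2 - (2 * t) * h x + t ^ 2) ∂μ := by
        congr 1; ext x; ring
      rw [e3, integral_add (hi _ (by fun_prop)) (integrable_const _),
        integral_sub (hi _ (by fun_prop)) (hi _ (by fun_prop)), integral_const_mul, e1] at e2
      simp at e2
      nlinarith
    nlinarith [sq_nonneg ((∫ x, g x ∂μ) - c)]
  rw [← hcg]; exact hc0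

lemma exists_window (T : C(X, X)) (x0 : X) (μ : Measure X) [IsProbabilityMeasure μ]
    (he : Ergodic T μ) (hY : ∀ᵐ y ∂μ, y ∈ closure (Set.range fun n : ℕ => T^[n] x0))
    (F : Finset C(X, ℝ)) (ε : ℝ) (hε : 0 < ε) (K : ℕ) :
    ∃ n N : ℕ, K ≤ N ∧ ∀ f ∈ F, |avg T (T^[n] x0) N f - ∫ y, f y ∂μ| < ε := by
  have hi : ∀ h : X → ℝ, Continuous h → Integrable h μ := fun h hh =>
    hh.integrable_of_hasCompactSupport (HasCompactSupport.of_compactSpace _)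
  have hlim : Tendsto (fun n => ∑ f ∈ F, ∫ x, (avg T x n f - ∫ y, f y ∂μ) ^ 2 ∂μ) atTop
      (𝓝 0) := by
    have := tendsto_finsetSum F (fun f _ => mean_ergodic_s9 T μ he f)
    simpa using this
  obtain ⟨N, hN, hKN⟩ := ((hlim.eventually (gt_mem_nhds (show (0 : ℝ) < ε ^ 2 by positivity))).and
    (eventually_ge_atTop K)).exists
  have hc : ∀ f : C(X, ℝ), Continuous fun x => (avg T x N f - ∫ y, f y ∂μ) ^ 2 := fun f =>
    ((avg_continuous T N f).sub continuous_const).pow 2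
  rw [← integral_finsetSum _ (fun f _ => hi _ (hc f))] at hN
  set H : X → ℝ := fun x => ∑ f ∈ F, (avg T x N f - ∫ y, f y ∂μ) ^ 2 with hH
  have hHc : Continuous H := continuous_finsetSum _ fun f _ => hc f
  obtain ⟨y, hyY, hy⟩ : ∃ y ∈ closure (Set.range fun n : ℕ => T^[n] x0), H y < ε ^ 2 := by
    by_contra! hcon
    have h1 : ∫ x, ε ^ 2 ∂μ ≤ ∫ x, H x ∂μ := by
      refine integral_mono_ae (integrable_const _) (hi _ hHc) ?_
      filter_upwards [hY] with y hy using hcon y hy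
    simp at h1
    linarith
  obtain ⟨_, hz, ⟨n, rfl⟩⟩ := mem_closure_iff.1 hyY {z | H z < ε ^ 2}
    (isOpen_lt hHc continuous_const) hy
  refine ⟨n, N, hKN, fun f hf => ?_⟩
  have h2 : (avg T (T^[n] x0) N f - ∫ y, f y ∂μ) ^ 2 ≤ H (T^[n] x0) :=
    Finset.single_le_sum (f := fun f : C(X, ℝ) => (avg T (T^[n] x0) N f - ∫ y, f y ∂μ) ^ 2)
      (fun f _ => sq_nonneg _) hf
  exact abs_lt_of_sq_lt_sq (h2.trans_lt hz) hε.le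

lemma avg_shift (T : C(X, X)) (x0 : X) (n N : ℕ) (g : C(X, ℝ)) :
    avg T (T^[n] x0) N g = (∑ i ∈ Finset.Ico n (n + N), g (T^[i] x0)) /
      ((Finset.Ico n (n + N)).card : ℝ) := by
  rw [avg, Finset.sum_Ico_eq_sum_range]
  simp only [Nat.card_Ico, add_tsub_cancel_left]
  congr 1
  refine Finset.sum_congr rfl fun i _ => ?_
  rw [add_comm, Function.iterate_add_apply]

lemma avg_sub_le (T : C(X, X)) (x : X) (N : ℕ) (f g : C(X, ℝ)) :
    |avg T x N f - avg T x N g| ≤ ‖f - g‖ := by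
  rcases Nat.eq_zero_or_pos N with rfl | hn
  · simp [avg]
  have hn' : (0 : ℝ) < N := by exact_mod_cast hn
  rw [avg, avg, ← sub_div, ← Finset.sum_sub_distrib, abs_div, abs_of_pos hn', div_le_iff₀ hn']
  calc _ ≤ ∑ i ∈ Finset.range N, |f (T^[i] x) - g (T^[i] x)| := Finset.abs_sum_le_sum_abs _ _
    _ ≤ ∑ i ∈ Finset.range N, ‖f - g‖ :=
        Finset.sum_le_sum fun i _ => (f - g).norm_coe_le_norm (T^[i] x)
    _ = _ := by simp; ring

lemma folner_windows (n N : ℕ → ℕ) (hN : ∀ i, i + 1 ≤ N i) :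
    IsFolnerSeq (fun i => Finset.Ico (n i) (n i + N i)) := by
  refine ⟨fun i => ?_, fun t => ?_⟩
  · have := hN i
    exact Finset.nonempty_Ico.2 (by omega)
  · have hNt : Tendsto (fun i => (N i : ℝ)) atTop atTop :=
      tendsto_natCast_atTop_atTop.comp (tendsto_atTop_mono (fun i => (Nat.le_succ i).trans (hN i))
        tendsto_id)
    have h1 : Tendsto (fun i => 1 - (t : ℝ) / N i) atTop (𝓝 1) := by
      have := (tendsto_const_nhds (x := (1 : ℝ))).sub
        ((tendsto_const_nhds (x := (t : ℝ))).div_atTop hNt)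
      simpa using this
    refine h1.congr' ?_
    filter_upwards [eventually_ge_atTop t] with i hi
    have h2 : Finset.Ico (n i) (n i + N i) ∩ (Finset.Ico (n i) (n i + N i)).image (fun k => t + k)
        = Finset.Ico (n i + t) (n i + N i) := by
      ext x
      simp only [Finset.mem_inter, Finset.mem_image, Finset.mem_Ico]
      constructor
      · rintro ⟨h1, y, h2, rfl⟩; omega
      · intro h
        exact ⟨by omega, x - t, by omega, by omega⟩
    rw [h2]
    have h3 := hN i
    have h4 : (N i : ℝ) ≠ 0 := by
      have : 0 < N i := by omega
      positivity
    have h5 : n i + N i - (n i + t) = N i - t := by omega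
    simp only [Nat.card_Ico, add_tsub_cancel_left, h5]
    rw [Nat.cast_sub (by omega)]
    field_simp

theorem exists_ergodic_generic (T : C(X, X)) (x0 : X) (f : C(X, ℝ)) (c : ℝ) (N : ℕ → ℕ)
    (hN : Tendsto N atTop atTop)
    (h : ∀ ε > 0, ∀ᶠ i in atTop, c - ε ≤ avg T x0 (N i) f) :
    ∃ (μ : Measure X) (Φ : ℕ → Finset ℕ), IsProbabilityMeasure μ ∧ Ergodic T μ ∧
      IsFolnerSeq Φ ∧ GenericAlong T μ x0 Φ ∧ c ≤ ∫ x, f x ∂μ := by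
  obtain ⟨L, hL, hcL⟩ := exists_extreme T x0 f c (exists_state T x0 f c N hN h)
  obtain ⟨μ, hp, hint, hmp, hY⟩ := exists_measure hL.1
  have he := ergodic_of_extreme hL μ hint hmp hY
  have : Nonempty C(X, ℝ) := ⟨0⟩
  let d := TopologicalSpace.denseSeq C(X, ℝ)
  have hd : DenseRange d := TopologicalSpace.denseRange_denseSeq _
  classical
  choose n M hM hnM using fun i : ℕ => exists_window T x0 μ he hY
    ((Finset.range (i + 1)).image d) (1 / ((i : ℝ) + 1)) (by positivity) (i + 1)
  refine ⟨μ, fun i => Finset.Ico (n i) (n i + M i), hp, he, folner_windows n M hM, ?_, ?_⟩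
  · intro g
    rw [Metric.tendsto_atTop]
    intro ε hε
    obtain ⟨j, hj⟩ := hd.exists_dist_lt g (show 0 < ε / 3 by positivity)
    obtain ⟨K, hK⟩ := exists_nat_one_div_lt (show 0 < ε / 3 by positivity)
    refine ⟨max j K, fun i hi => ?_⟩
    have hij : j ≤ i := (le_max_left _ _).trans hi
    have hiK : K ≤ i := (le_max_right _ _).trans hi
    rw [← avg_shift, Real.dist_eq]
    have h1 := hnM i (d j) (Finset.mem_image_of_mem _ (Finset.mem_range.2 (by omega)))
    have h2 : 1 / ((i : ℝ) + 1) ≤ 1 / ((K : ℝ) + 1) := by gcongr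
    have h3 := avg_sub_le T (T^[n i] x0) (M i) g (d j)
    have hi : ∀ h : C(X, ℝ), Integrable h μ := fun h =>
      h.continuous.integrable_of_hasCompactSupport (HasCompactSupport.of_compactSpace _)
    have h4 : |(∫ x, d j x ∂μ) - ∫ x, g x ∂μ| ≤ ‖g - d j‖ := by
      rw [← integral_sub (hi _) (hi _)]
      have := norm_integral_le_of_norm_le_const (μ := μ) (f := fun x => d j x - g x)
        (C := ‖g - d j‖) (Eventually.of_forall fun x => by
          rw [norm_sub_rev]; exact (g - d j).norm_coe_le_norm x)
      simpa using this
    rw [dist_eq_norm] at hj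
    rw [abs_lt] at *
    rw [abs_le] at *
    constructor <;> linarith [h1.1, h1.2, h3.1, h3.2, h4.1, h4.2]
  · rw [hint]; exact hcL

end

lemma shiftS_iter (n : ℕ) (x : BinSeq) (z : ℤ) : shiftS^[n] x z = x (z + n) := by
  induction n generalizing x z with
  | zero => simp
  | succ n ih =>
    rw [Function.iterate_succ_apply, ih, shiftS]
    congr 1
    push_cast; ring

lemma shiftS_continuous : Continuous shiftS := by
  unfold shiftS
  fun_prop

lemma sum_blocks (f : ℕ → ℝ) (p n : ℕ) :
    ∑ i ∈ Finset.range n, ∑ j ∈ Finset.range p, f (p * i + j) = ∑ i ∈ Finset.range (p * n), f i := by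
  induction n with
  | zero => simp
  | succ n ih => rw [Finset.sum_range_succ, ih, mul_add, mul_one, Finset.sum_range_add]

open scoped Classical in
/-- indicator of `A` -/
noncomputable def indA (A : Set ℕ) (n : ℕ) : ℝ := if n ∈ A then 1 else 0

lemma indA_nonneg (A : Set ℕ) (n : ℕ) : 0 ≤ indA A n := by
  unfold indA; split_ifs <;> norm_num

lemma indA_le_one (A : Set ℕ) (n : ℕ) : indA A n ≤ 1 := by
  unfold indA; split_ifs <;> norm_num

lemma exists_good (A : Set ℕ) (D : ℕ) (hD : 0 < D) (ε : ℝ) (hε : 0 < ε) (K : ℕ) :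
    ∃ n, K ≤ n ∧ 0 < n ∧
      (upperDensity A - ε) * (D * n) ≤ ∑ i ∈ Finset.range (D * n), indA A i := by
  classical
  set d := upperDensity A with hd
  have hfr : ∃ᶠ M : ℕ in atTop, d - ε / 2 <
      (((Finset.Icc 1 M).filter (· ∈ A)).card : ℝ) / M := by
    apply Filter.frequently_lt_of_lt_limsup
    · refine Filter.IsCoboundedUnder.of_frequently_ge (a := 0) ?_
      exact Frequently.of_forall fun M => by positivity
    · have : upperDensity A = limsup (fun N : ℕ => (((Finset.Icc 1 N).filter (· ∈ A)).card : ℝ) / N)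
          atTop := by
        unfold upperDensity
        congr! 
      rw [← this]
      linarith
  obtain ⟨B, hB⟩ := exists_nat_ge (2 * |d| * D / ε)
  obtain ⟨M, hM, hlt⟩ := (frequently_atTop.1 hfr) (max B (D * K) + 1)
  have hMB : B ≤ M := by have := le_max_left B (D * K); omega
  have hMK : D * K ≤ M := by have := le_max_right B (D * K); omega
  have hM0 : (0 : ℝ) < M := by
    have : 0 < M := by omega
    positivity
  rw [lt_div_iff₀ hM0] at hlt
  refine ⟨M / D + 1, ?_, Nat.succ_pos _, ?_⟩
  · have : K ≤ M / D := (Nat.le_div_iff_mul_le hD).2 (by rw [mul_comm]; exact hMK)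
    omega
  have h1 : M < D * (M / D + 1) := by
    have := Nat.lt_mul_div_succ M hD
    simpa using this
  have h2 : D * (M / D + 1) ≤ M + D := by
    have := Nat.mul_div_le M D
    rw [mul_add]; omega
  have hcnt : (((Finset.Icc 1 M).filter (· ∈ A)).card : ℝ)
      ≤ ∑ i ∈ Finset.range (D * (M / D + 1)), indA A i := by
    have : (((Finset.Icc 1 M).filter (· ∈ A)).card : ℝ) = ∑ i ∈ Finset.Icc 1 M, indA A i := by
      rw [Finset.card_filter]; push_cast
      refine Finset.sum_congr rfl fun i _ => ?_
      unfold indA; congr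
    rw [this]
    refine Finset.sum_le_sum_of_subset_of_nonneg ?_ (fun i _ _ => indA_nonneg A i)
    intro i hi
    simp only [Finset.mem_Icc, Finset.mem_range] at *
    omega
  refine le_trans ?_ hcnt
  have h2' : (D : ℝ) * ((M / D + 1 : ℕ) : ℝ) ≤ M + D := by exact_mod_cast h2
  rcases le_or_gt (d - ε) 0 with hneg | hpos
  · have : (0 : ℝ) ≤ D * ((M / D + 1 : ℕ) : ℝ) := by positivity
    nlinarith [Nat.cast_nonneg (α := ℝ) ((Finset.Icc 1 M).filter (· ∈ A)).card]
  · have h3 : (d - ε) * (D * ((M / D + 1 : ℕ) : ℝ)) ≤ (d - ε) * (M + D) := by gcongr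
    have h4 : 2 * |d| * D ≤ M * ε := by
      rw [div_le_iff₀ hε] at hB
      have : (B : ℝ) ≤ M := by exact_mod_cast hMB
      nlinarith
    have h5 : d ≤ |d| := le_abs_self d
    have h6 : (0 : ℝ) < D := by exact_mod_cast hD
    nlinarith

/-- **Correspondence principle for shifted unrestricted sumsets.** -/
theorem correspondence_shift (A : Set ℕ) (ℓ m : ℕ) (hℓ : 0 < ℓ) (hm : 0 < m)
    (k : ℝ) (hk : k = (m : ℝ) / ℓ) (q : ℕ) (hq : q = ⌈k⌉₊) :
    ∃ (μ : Measure (BinSeq × BinSeq)) (E : Set BinSeq) (a a' : BinSeq)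
      (Φ : ℕ → Finset ℕ),
      IsProbabilityMeasure μ ∧
      Ergodic (fun p : BinSeq × BinSeq => (shiftS^[q + 1] p.1, shiftS p.2)) μ ∧
      IsOpen E ∧ IsFolnerSeq Φ ∧
      GenericAlong (fun p : BinSeq × BinSeq => (shiftS^[q + 1] p.1, shiftS p.2))
        μ (a', a) Φ ∧
      ((ℓ : ℝ) + m) * (μ (Set.univ ×ˢ E)).toReal
          + ℓ * (∑ j ∈ Finset.range (q + 1),
              (μ ((shiftS^[j] ⁻¹' E) ×ˢ (Set.univ : Set BinSeq))).toReal)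
        ≥ ((ℓ : ℝ) + m) * ((k + 1) * upperDensity A - k)
          + ℓ * (k + 1) * upperDensity A + ℓ * ((q : ℝ) - k) ∧
      A = {n : ℕ | shiftS^[n] a ∈ E} ∧
      ∀ j < ℓ + m, {n : ℕ | n * (ℓ + m) + j ∈ A}
        = {n : ℕ | shiftS^[(q + 1) * ℓ * n + j] a' ∈ E} := by
  classical
  have hℓ' : (0 : ℝ) < ℓ := by exact_mod_cast hℓ
  set D := ℓ + m with hD
  set Q := (q + 1) * ℓ with hQ
  have hDQ : D ≤ Q := by
    have h1 : k ≤ q := by rw [hq]; exact Nat.le_ceil k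
    rw [hk, div_le_iff₀ hℓ'] at h1
    have h2 : m ≤ q * ℓ := by exact_mod_cast h1
    rw [hD, hQ, add_mul]; omega
  have hQ0 : 0 < Q := by omega
  let E : Set BinSeq := {x | x 0 = true}
  have hcl : ∀ z : ℤ, IsClopen {x : BinSeq | x z = true} := fun z =>
    (isClopen_discrete {true}).preimage (continuous_apply z)
  let a : BinSeq := fun z => decide (z.toNat ∈ A)
  let a' : BinSeq := fun z =>
    if z.toNat % Q < D then decide (z.toNat / Q * D + z.toNat % Q ∈ A) else true
  let T : C(BinSeq × BinSeq, BinSeq × BinSeq) :=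
    ⟨fun p => (shiftS^[q + 1] p.1, shiftS p.2),
      ((shiftS_continuous.iterate _).comp continuous_fst).prodMk
        (shiftS_continuous.comp continuous_snd)⟩
  have hTi : ∀ (n : ℕ) (p : BinSeq × BinSeq),
      T^[n] p = (shiftS^[(q + 1) * n] p.1, shiftS^[n] p.2) := by
    intro n p
    induction n with
    | zero => simp
    | succ n ih =>
      rw [Function.iterate_succ_apply', ih]
      show (shiftS^[q + 1] (shiftS^[(q + 1) * n] p.1), shiftS (shiftS^[n] p.2)) = _
      rw [← Function.iterate_add_apply, ← Function.iterate_succ_apply' shiftS]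
      congr 2
      ring_nf
  let s1 : ℕ → Set (BinSeq × BinSeq) := fun j => (shiftS^[j] ⁻¹' E) ×ˢ (Set.univ : Set BinSeq)
  let s2 : Set (BinSeq × BinSeq) := Set.univ ×ˢ E
  have hE : IsClopen E := hcl 0
  have hs1 : ∀ j, IsClopen (s1 j) := fun j =>
    (hE.preimage (shiftS_continuous.iterate j)).prod isClopen_univ
  have hs2 : IsClopen s2 := isClopen_univ.prod hE
  let g1 : ℕ → C(BinSeq × BinSeq, ℝ) := fun j =>
    ⟨(s1 j).indicator 1, continuous_one.indicator (fun x hx => by simp [(hs1 j).frontier_eq] at hx)⟩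
  let g2 : C(BinSeq × BinSeq, ℝ) := ⟨s2.indicator 1, continuous_one.indicator (fun x hx => by simp [hs2.frontier_eq] at hx)⟩
  let f : C(BinSeq × BinSeq, ℝ) :=
    ((ℓ : ℝ) + m) • g2 + (ℓ : ℝ) • ∑ j ∈ Finset.range (q + 1), g1 j
  let b' : ℕ → ℝ := fun i => if i % Q < D then indA A (i / Q * D + i % Q) else 1
  have hg2 : ∀ i, g2 (T^[i] (a', a)) = indA A i := by
    intro i
    rw [hTi]
    show s2.indicator 1 _ = _
    simp [s2, E, Set.indicator_apply, shiftS_iter, a, indA]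
  have hg1 : ∀ i j, g1 j (T^[i] (a', a)) = b' ((q + 1) * i + j) := by
    intro i j
    rw [hTi]
    show (s1 j).indicator 1 _ = _
    have e : (((j : ℤ) + (((q + 1) * i : ℕ) : ℤ))).toNat = (q + 1) * i + j := by omega
    simp only [s1, E, Set.indicator_apply, Set.mem_prod, Set.mem_preimage, Set.mem_ofPred_eq,
      shiftS_iter, zero_add, Set.mem_univ, and_true, a', b', e, indA, Pi.one_apply]
    split_ifs <;> simp_all
  have hcount : ∀ n, ∑ i ∈ Finset.range (Q * n), b' i
      = ∑ i ∈ Finset.range (D * n), indA A i + ((Q : ℝ) - D) * n := by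
    intro n
    rw [← sum_blocks, ← sum_blocks]
    have : ∀ i, ∑ j ∈ Finset.range Q, b' (Q * i + j)
        = ∑ j ∈ Finset.range D, indA A (D * i + j) + ((Q : ℝ) - D) := by
      intro i
      obtain ⟨R, hR⟩ := Nat.exists_eq_add_of_le hDQ
      have h1 : ∀ j < Q, b' (Q * i + j) = if j < D then indA A (D * i + j) else 1 := by
        intro j hj
        simp only [b', Nat.mul_add_mod, Nat.mod_eq_of_lt hj, Nat.mul_add_div hQ0,
          Nat.div_eq_of_lt hj, add_zero, mul_comm D i]
      rw [Finset.sum_congr rfl (fun j hj => h1 j (Finset.mem_range.1 hj)), hR,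
        Finset.sum_range_add]
      congr 1
      · exact Finset.sum_congr rfl fun j hj => if_pos (Finset.mem_range.1 hj)
      · simp
    rw [Finset.sum_congr rfl fun i _ => this i, Finset.sum_add_distrib]
    simp; ring
  -- the lower bound for averages
  have havg : ∀ n : ℕ, 0 < n → ∀ δ : ℝ,
      δ * (D * n) ≤ ∑ i ∈ Finset.range (D * n), indA A i →
      ((ℓ : ℝ) + m) * ((k + 1) * δ - k) + ℓ * (k + 1) * δ + ℓ * ((q : ℝ) - k)
        ≤ avg T (a', a) (ℓ * n) f := by
    intro n hn δ hδ
    have hn' : (0 : ℝ) < n := by exact_mod_cast hn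
    have e1 : ∑ i ∈ Finset.range (ℓ * n), f (T^[i] (a', a))
        = ((ℓ : ℝ) + m) * ∑ i ∈ Finset.range (ℓ * n), indA A i
          + ℓ * ∑ i ∈ Finset.range (Q * n), b' i := by
      have : ∀ i, f (T^[i] (a', a)) = ((ℓ : ℝ) + m) * indA A i
          + ℓ * ∑ j ∈ Finset.range (q + 1), b' ((q + 1) * i + j) := by
        intro i
        rw [← hg2, ← Finset.sum_congr rfl fun j _ => hg1 i j]
        simp [f]
      rw [Finset.sum_congr rfl fun i _ => this i, Finset.sum_add_distrib, ← Finset.mul_sum,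
        ← Finset.mul_sum, sum_blocks, hQ, mul_assoc]
    have e2 : ∑ i ∈ Finset.range (D * n), indA A i ≤
        ∑ i ∈ Finset.range (ℓ * n), indA A i + m * n := by
      rw [hD, add_mul, Finset.sum_range_add]
      gcongr
      calc _ ≤ ∑ i ∈ Finset.range (m * n), (1 : ℝ) :=
            Finset.sum_le_sum fun i _ => indA_le_one _ _
        _ = _ := by simp
    rw [avg, e1, hcount, le_div_iff₀ (by push_cast; positivity)]
    have hkm : k * ℓ = m := by rw [hk]; field_simp
    have hDr : (D : ℝ) = ℓ + m := by rw [hD]; push_cast; ring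
    have hQr : (Q : ℝ) = (q + 1) * ℓ := by rw [hQ]; push_cast; ring
    rw [hDr] at hδ
    rw [hDr, hQr]
    push_cast
    set s := ∑ i ∈ Finset.range (D * n), indA A i
    set t := ∑ i ∈ Finset.range (ℓ * n), indA A i
    have e3 : ((ℓ : ℝ) + m) * (δ * ((ℓ + m) * n) - m * n) ≤ ((ℓ : ℝ) + m) * t := by
      gcongr; linarith
    have e4 : (ℓ : ℝ) * (δ * ((ℓ + m) * n)) ≤ ℓ * s := by gcongr
    have e5 : (((ℓ : ℝ) + m) * ((k + 1) * δ - k) + ℓ * (k + 1) * δ + ℓ * ((q : ℝ) - k)) * (ℓ * n)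
        = ((ℓ : ℝ) + m) * (δ * ((ℓ + m) * n) - m * n) + (ℓ : ℝ) * (δ * ((ℓ + m) * n))
          + ℓ * (((q + 1) * ℓ - (ℓ + m)) * n) := by
      rw [← hkm]; ring
    rw [e5]
    linarith
  choose N hNK hN0 hN using fun i : ℕ => exists_good A D (by omega) (1 / ((i : ℝ) + 1))
    (by positivity) i
  have hk0 : 0 ≤ k := by rw [hk]; positivity
  obtain ⟨μ, Φ, hp, he, hF, hG, hc⟩ := exists_ergodic_generic T (a', a) f
    (((ℓ : ℝ) + m) * ((k + 1) * upperDensity A - k)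
          + ℓ * (k + 1) * upperDensity A + ℓ * ((q : ℝ) - k)) (fun i => ℓ * N i)
    (tendsto_atTop_mono (fun i => (hNK i).trans (Nat.le_mul_of_pos_left _ hℓ)) tendsto_id)
    (by
      intro ε hε
      have hlim : Tendsto (fun i : ℕ => (((ℓ : ℝ) + m) * (k + 1) + ℓ * (k + 1)) *
          (1 / ((i : ℝ) + 1))) atTop (𝓝 0) := by
        simpa using tendsto_one_div_add_atTop_nhds_zero_nat.const_mul
          (((ℓ : ℝ) + m) * (k + 1) + ℓ * (k + 1))
      filter_upwards [hlim.eventually (gt_mem_nhds hε)] with i hi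
      have := havg (N i) (hN0 i) _ (hN i)
      refine le_trans ?_ this
      linarith)
  refine ⟨μ, E, a, a', Φ, hp, he, hE.isOpen, hF, hG, ?_, ?_, ?_⟩
  · have hi : ∀ h : C(BinSeq × BinSeq, ℝ), Integrable h μ := fun h =>
      h.continuous.integrable_of_hasCompactSupport (HasCompactSupport.of_compactSpace _)
    have i1 : ∀ j, ∫ x, g1 j x ∂μ = (μ (s1 j)).toReal := fun j =>
      integral_indicator_one (hs1 j).isOpen.measurableSet
    have i2 : ∫ x, g2 x ∂μ = (μ s2).toReal := integral_indicator_one hs2.isOpen.measurableSet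
    have i3 : ∫ x, f x ∂μ = ((ℓ : ℝ) + m) * ∫ x, g2 x ∂μ
        + ℓ * ∑ j ∈ Finset.range (q + 1), ∫ x, g1 j x ∂μ := by
      have : ∀ x, f x = ((ℓ : ℝ) + m) * g2 x + ℓ * ∑ j ∈ Finset.range (q + 1), g1 j x := by
        intro x; simp [f]
      simp_rw [this]
      rw [integral_add ((hi _).const_mul _) ((integrable_finsetSum _ fun j _ => hi _).const_mul _),
        integral_const_mul, integral_const_mul, integral_finsetSum _ fun j _ => hi _]
    rw [i3, i2, Finset.sum_congr rfl fun j _ => i1 j] at hc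
    exact hc
  · ext n
    simp [E, shiftS_iter, a]
  · intro j hj
    ext n
    have e : (((Q * n + j : ℕ) : ℤ)).toNat = Q * n + j := by omega
    have hjQ : j < Q := by omega
    simp only [Set.mem_ofPred_eq, E, shiftS_iter, zero_add, a', e, Nat.mul_add_mod,
      Nat.mod_eq_of_lt hjQ, Nat.mul_add_div hQ0, Nat.div_eq_of_lt hjQ, add_zero, if_pos hj,
      decide_eq_true_eq]
end
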